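/- Let P be a cyclic polygon with n vertices, p linkable pairs, and rotation number r, and suppose P admits a star decomposition. Then every maximal star decomposition of P contains exactly p − (n−2r)(n−2r−1)/2 diagonals. -/

import Mathlib

open Complex
open scoped Classical

noncomputable section

/-- The anticlockwise arc displacement from `u` to `v` on the unit circle, lying in `(0, 2π]`
(equal to `2π` when `v = u`). -/
def posArc (u v : ℂ) : ℝ :=
  if 0 < Complex.arg (v / u) then Complex.arg (v / u) else Complex.arg (v / u) + 2 * Real.pi

/-- `u, v, w` occur in anticlockwise order on the circle. -/
def ACW (u v w : ℂ) : Prop :=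
  u ≠ v ∧ v ≠ w ∧ u ≠ w ∧ posArc u v < posArc u w

/-- The open anticlockwise arc from `u` to `v`. -/
def arcOO (u v : ℂ) : Set ℂ := {x | x ≠ u ∧ x ≠ v ∧ posArc u x < posArc u v}

/-- The anticlockwise arc from `u` to `v`, open at `u` and closed at `v`. -/
def arcOC (u v : ℂ) : Set ℂ := {x | x ≠ u ∧ (x = v ∨ posArc u x < posArc u v)}

/-- The closed anticlockwise arc from `u` to `v`. -/
def arcCC (u v : ℂ) : Set ℂ := {x | x = u ∨ x = v ∨ (x ≠ u ∧ posArc u x < posArc u v)}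

/-- The (undirected) angle `∠ x v z` at apex `v`. -/
def vangle (x v z : ℂ) : ℝ := |Complex.arg ((x - v) / (z - v))|

/-- A cyclic polygon: a finite set of vertices on the unit circle together with a set of
directed edges such that every vertex has indegree and outdegree one, and any two
consecutive edges `uv`, `vw` have `u, v, w` in anticlockwise order. -/
structure CyclicPolygon where
  V : Finset ℂ
  E : Finset (ℂ × ℂ)
  nonempty : V.Nonempty
  onCircle : ∀ v ∈ V, ‖v‖ = 1
  endmem : ∀ e ∈ E, e.1 ∈ V ∧ e.2 ∈ V
  outdeg : ∀ v ∈ V, ∃! w, (v, w) ∈ E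
  indeg : ∀ v ∈ V, ∃! u, (u, v) ∈ E
  acw : ∀ u v w : ℂ, (u, v) ∈ E → (v, w) ∈ E → ACW u v w

namespace CyclicPolygon

/-- The successor `v⁺` of a vertex. -/
noncomputable def next (P : CyclicPolygon) (v : ℂ) : ℂ :=
  if h : ∃ w, (v, w) ∈ P.E then h.choose else v

/-- The predecessor `v⁻` of a vertex. -/
noncomputable def prev (P : CyclicPolygon) (v : ℂ) : ℂ :=
  if h : ∃ u, (u, v) ∈ P.E then h.choose else v

end CyclicPolygon

/-- The interior angle `∠ v⁻ v v⁺` of `P` at `v`. -/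
def interiorAngle (P : CyclicPolygon) (v : ℂ) : ℝ :=
  vangle (P.prev v) v (P.next v)

/-- The length of an edge `uv`: the number of vertices on the open anticlockwise
arc from `u` to `v`, plus one. -/
def edgeLength (P : CyclicPolygon) (u v : ℂ) : ℕ :=
  ((P.V : Set ℂ) ∩ arcOO u v).ncard + 1

/-- A `k`-star: a cyclic polygon with `2k+1` vertices all of whose edges have length `k`. -/
def IsKStar (S : CyclicPolygon) (k : ℕ) : Prop :=
  S.V.card = 2 * k + 1 ∧ ∀ e ∈ S.E, edgeLength S e.1 e.2 = k

/-- A star: a `k`-star for some positive integer `k`. -/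
def IsStar (S : CyclicPolygon) : Prop := ∃ k : ℕ, 0 < k ∧ IsKStar S k

/-- The segment from `u` to `x` splits the interior angle `∠ u⁻ u u⁺` of `S` at `u`
into the two (smaller, nonzero) angles `∠ u⁻ u x` and `∠ x u u⁺`. -/
def SplitsVertexAngle (S : CyclicPolygon) (u x : ℂ) : Prop :=
  u ∈ S.V ∧ 0 < vangle (S.prev u) u x ∧ 0 < vangle x u (S.next u) ∧
    vangle (S.prev u) u x + vangle x u (S.next u) = vangle (S.prev u) u (S.next u)

/-- `(u, v)` is a linkable pair for the pair of cyclic polygons `(S₁, S₂)`: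
the segment `uv` splits the angle of `S₁` at `u` and the angle of `S₂` at `v`. -/
def LinkablePair (S₁ S₂ : CyclicPolygon) (u v : ℂ) : Prop :=
  u ≠ v ∧ SplitsVertexAngle S₁ u v ∧ SplitsVertexAngle S₂ v u

/-- `u, v` is a linkable pair of vertices of the cyclic polygon `P`. -/
def Linkable (P : CyclicPolygon) (u v : ℂ) : Prop := LinkablePair P P u v

/-- `D` is a set of (undirected) diagonals of `P`, i.e. every member joins a linkable pair. -/
def IsDiagonalSet (P : CyclicPolygon) (D : Set (Sym2 ℂ)) : Prop :=
  ∀ u v : ℂ, s(u, v) ∈ D → Linkable P u v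

/-- The set `D̃` of directed edges associated to a set of diagonals `D`. -/
def tilde (D : Set (Sym2 ℂ)) : Set (ℂ × ℂ) := {e | s(e.1, e.2) ∈ D}

/-- The segment from `v` towards `x` splits the angle `∠ u v w`. -/
def SplitsAngle3 (u v w x : ℂ) : Prop :=
  0 < vangle u v x ∧ 0 < vangle x v w ∧ vangle u v x + vangle x v w = vangle u v w

/-- `𝒮` is a star decomposition of `P` with respect to the diagonal set `D`: the
cycle decomposition of `E ∪ D̃` determined by `f_next` (each cycle follows the
tightest turn, i.e. no diagonal of `D` splits the angle between two consecutive
edges of a cycle), all of whose cycles are stars. -/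
def IsStarDecomp (P : CyclicPolygon) (D : Set (Sym2 ℂ)) (𝒮 : Finset CyclicPolygon) : Prop :=
  IsDiagonalSet P D ∧
  (∀ S ∈ 𝒮, IsStar S ∧ (S.V : Set ℂ) ⊆ (P.V : Set ℂ)) ∧
  (∀ S ∈ 𝒮, (S.E : Set (ℂ × ℂ)) ⊆ (P.E : Set (ℂ × ℂ)) ∪ tilde D) ∧
  (∀ e ∈ (P.E : Set (ℂ × ℂ)) ∪ tilde D, ∃ S ∈ 𝒮, e ∈ S.E) ∧
  (∀ S₁ ∈ 𝒮, ∀ S₂ ∈ 𝒮, S₁ ≠ S₂ → ∀ e : ℂ × ℂ, e ∈ S₁.E → e ∉ S₂.E) ∧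
  (∀ S ∈ 𝒮, ∀ u v w : ℂ, (u, v) ∈ S.E → (v, w) ∈ S.E →
      ¬ ∃ x, s(v, x) ∈ D ∧ SplitsAngle3 u v w x)

/-- `P` admits a star decomposition with respect to `D`. -/
def HasStarDecomp (P : CyclicPolygon) (D : Set (Sym2 ℂ)) : Prop :=
  ∃ 𝒮 : Finset CyclicPolygon, IsStarDecomp P D 𝒮

/-- A maximal star decomposition: no proper superset of `D` admits a star decomposition. -/
def IsMaximalStarDecomp (P : CyclicPolygon) (D : Set (Sym2 ℂ))
    (𝒮 : Finset CyclicPolygon) : Prop :=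
  IsStarDecomp P D 𝒮 ∧ ∀ D' : Set (Sym2 ℂ), D ⊂ D' → ¬ HasStarDecomp P D'

/-- `D'` is obtained from `D` by a diagonal flip: remove one diagonal and add another. -/
def FlipStep (D D' : Set (Sym2 ℂ)) : Prop :=
  ∃ e f : Sym2 ℂ, e ∈ D ∧ f ∉ D ∧ D' = (D \ {e}) ∪ {f}

/-- The two chords `ab` and `cd` are crossing: they share no endpoint and
intersect inside the circle. -/
def Crossing (a b c d : ℂ) : Prop :=
  a ≠ c ∧ a ≠ d ∧ b ≠ c ∧ b ≠ d ∧ (openSegment ℝ a b ∩ openSegment ℝ c d).Nonempty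

/-- The two chords `ab` and `cd` share a common point: they have a common
endvertex or intersect inside the circle. -/
def ShareCommonPoint (a b c d : ℂ) : Prop :=
  a = c ∨ a = d ∨ b = c ∨ b = d ∨ (openSegment ℝ a b ∩ openSegment ℝ c d).Nonempty

/-- Two cyclic polygons have a pair of overlapped angles: a common vertex `y` and a vertex
`x` of either polygon lying on both arcs `⦅y⁺ y⁻⟧` (taken in each polygon). -/
def OverlappedAngles (S₁ S₂ : CyclicPolygon) : Prop :=
  ∃ y : ℂ, y ∈ S₁.V ∧ y ∈ S₂.V ∧
    ∃ x : ℂ, (x ∈ S₁.V ∨ x ∈ S₂.V) ∧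
      x ∈ arcOC (S₁.next y) (S₁.prev y) ∧ x ∈ arcOC (S₂.next y) (S₂.prev y)

/-- Two cyclic polygons are mutually independent: no two of their angles are overlapped. -/
def IndepPolygons (S₁ S₂ : CyclicPolygon) : Prop := ¬ OverlappedAngles S₁ S₂

/-- The edge `uv` of `P` is minimal: no edge `xy` of `P` has all vertices of the closed
arc from `x` to `y` inside the open arc from `u` to `v`. -/
def MinimalEdge (P : CyclicPolygon) (u v : ℂ) : Prop :=
  (u, v) ∈ P.E ∧
    ¬ ∃ x y : ℂ, (x, y) ∈ P.E ∧ ∀ z ∈ P.V, z ∈ arcCC x y → z ∈ arcOO u v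

/-- `vs` enumerates the star `S` as `v₀ v₁ ⋯ v₂ₖ` with `v₁ = v`, `v₀ = v⁻` (so that `v⁻v`
is an edge of `S`), each edge of `S` is an edge of `P` or a diagonal of `P`, and all the
edges `v₂ᵢ₋₁v₂ᵢ` are edges of `P`. -/
def IsBorderCandidate (P : CyclicPolygon) (v : ℂ) (S : CyclicPolygon) (k : ℕ)
    (vs : ℕ → ℂ) : Prop :=
  0 < k ∧ IsStar S ∧ S.V.card = 2 * k + 1 ∧
  (S.V : Set ℂ) ⊆ (P.V : Set ℂ) ∧
  vs 0 = P.prev v ∧ vs 1 = v ∧ vs (2 * k + 1) = vs 0 ∧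
  (∀ x ∈ S.V, ∃ i ≤ 2 * k, vs i = x) ∧
  (∀ i ≤ 2 * k, (vs i, vs (i + 1)) ∈ S.E) ∧
  (∀ i ≤ 2 * k, (vs i, vs (i + 1)) ∈ P.E ∨ Linkable P (vs i) (vs (i + 1))) ∧
  (∀ i : ℕ, 1 ≤ i → i ≤ k → (vs (2 * i - 1), vs (2 * i)) ∈ P.E)

/-- The angle sequence `(∠v₁v₂v₃, ∠v₃v₄v₅, …, ∠v₂ₖ₋₁v₂ₖv₀)` of an enumerated star. -/
noncomputable def angleList (vs : ℕ → ℂ) (k : ℕ) : List ℝ :=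
  (List.range k).map fun i => vangle (vs (2 * i + 1)) (vs (2 * i + 2)) (vs (2 * i + 3))

/-- `S` is the border star `S*(P, v)`: among all border candidates, its angle sequence is
lexicographically minimal. -/
def IsBorderStar (P : CyclicPolygon) (v : ℂ) (S : CyclicPolygon) : Prop :=
  ∃ (k : ℕ) (vs : ℕ → ℂ), IsBorderCandidate P v S k vs ∧
    ∀ (S' : CyclicPolygon) (k' : ℕ) (vs' : ℕ → ℂ), IsBorderCandidate P v S' k' vs' →
      ¬ List.Lex (· < ·) (angleList vs' k') (angleList vs k)


/-! ### Abstract (real) model of cyclic polygons: a circle of circumference one -/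

/-- Normalised anticlockwise arc between two points with coordinates `φ`. -/
def aarc {V : Type} (φ : V → ℝ) (u v : V) : ℝ :=
  if φ u < φ v then φ v - φ u else φ v - φ u + 1

/-- Abstract cyclic polygon. -/
structure APoly (V : Type) where
  φ : V → ℝ
  inj : Function.Injective φ
  bd : ∀ u v, φ v - φ u < 1
  nxt : Equiv.Perm V
  turn : ∀ u, aarc φ u (nxt u) < aarc φ u (nxt.symm u)

namespace APoly

variable {V : Type} (Q : APoly V)

def arc (u v : V) : ℝ := aarc Q.φ u v

def prv (v : V) : V := Q.nxt.symm v

theorem arc_pos (u v : V) : 0 < Q.arc u v := by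
  have := Q.bd v u
  unfold arc aarc; split_ifs <;> linarith

theorem arc_le (u v : V) : Q.arc u v ≤ 1 := by
  have := Q.bd u v
  unfold arc aarc; split_ifs <;> linarith

theorem arc_self (u : V) : Q.arc u u = 1 := by
  unfold arc aarc; simp

theorem arc_lt {u v : V} (h : u ≠ v) : Q.arc u v < 1 := by
  have := Q.bd u v
  have h2 : Q.φ u ≠ Q.φ v := fun h' => h (Q.inj h')
  unfold arc aarc; split_ifs with h3
  · linarith
  · have : Q.φ v < Q.φ u := lt_of_le_of_ne (not_lt.mp h3) (Ne.symm h2)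
    linarith

theorem ne_of_arc_lt {u v : V} (h : Q.arc u v < 1) : u ≠ v := by
  rintro rfl; rw [arc_self] at h; exact lt_irrefl _ h

theorem arc_add {u v : V} (h : u ≠ v) : Q.arc u v + Q.arc v u = 1 := by
  have h2 : Q.φ u ≠ Q.φ v := fun h' => h (Q.inj h')
  unfold arc aarc
  rcases lt_or_gt_of_ne h2 with h3 | h3
  · rw [if_pos h3, if_neg (not_lt.mpr h3.le)]; ring
  · rw [if_pos h3, if_neg (not_lt.mpr h3.le)]; ring

theorem arc_int (u v : V) : ∃ z : ℤ, Q.arc u v = Q.φ v - Q.φ u + z := by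
  unfold arc aarc; split_ifs
  · exact ⟨0, by simp⟩
  · exact ⟨1, by simp⟩

/-- characterisation of the arc from congruence and range -/
theorem arc_eq_of {u v : V} {t : ℝ} (h0 : 0 < t) (h1 : t ≤ 1) (z : ℤ)
    (h : t = Q.φ v - Q.φ u + z) : Q.arc u v = t := by
  obtain ⟨w, hw⟩ := Q.arc_int u v
  have a := Q.arc_pos u v
  have b := Q.arc_le u v
  have h3 : ((w - z : ℤ) : ℝ) < 1 := by push_cast; linarith
  have h4 : (-1 : ℝ) < ((w - z : ℤ) : ℝ) := by push_cast; linarith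
  have h5 : w - z < 1 := by exact_mod_cast h3
  have h6 : -1 < w - z := by exact_mod_cast h4
  have : w = z := by omega
  subst this; linarith

theorem arc_inj (u : V) {v w : V} (h : Q.arc u v = Q.arc u w) : v = w := by
  obtain ⟨x, hx⟩ := Q.arc_int u v
  obtain ⟨y, hy⟩ := Q.arc_int u w
  have a := Q.bd v w
  have b := Q.bd w v
  have h3 : ((x - y : ℤ) : ℝ) < 1 := by push_cast; linarith
  have h4 : (-1 : ℝ) < ((x - y : ℤ) : ℝ) := by push_cast; linarith
  have h5 : x - y < 1 := by exact_mod_cast h3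
  have h6 : -1 < x - y := by exact_mod_cast h4
  have : x = y := by omega
  subst this
  apply Q.inj; linarith

theorem turn' (u : V) : Q.arc u (Q.nxt u) < Q.arc u (Q.prv u) := Q.turn u

theorem nxt_prv (u : V) : Q.nxt (Q.prv u) = u := by simp [prv]
theorem prv_nxt (u : V) : Q.prv (Q.nxt u) = u := by simp [prv]

theorem nxt_ne (u : V) : u ≠ Q.nxt u :=
  Q.ne_of_arc_lt (lt_of_lt_of_le (Q.turn' u) (Q.arc_le _ _))

theorem prv_ne (u : V) : u ≠ Q.prv u := by
  intro h
  apply Q.nxt_ne u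
  conv_rhs => rw [h]
  rw [nxt_prv]

/-- `v` splits the angle at `u`. -/
def spl (u v : V) : Prop := Q.arc u (Q.nxt u) < Q.arc u v ∧ Q.arc u v < Q.arc u (Q.prv u)

/-- abstract linkable pairs -/
def link (u v : V) : Prop := Q.spl u v ∧ Q.spl v u

theorem link_symm {u v : V} (h : Q.link u v) : Q.link v u := ⟨h.2, h.1⟩

theorem link_ne {u v : V} (h : Q.link u v) : u ≠ v :=
  Q.ne_of_arc_lt (lt_of_lt_of_le h.1.2 (Q.arc_le _ _))

/-- abstract diagonal set -/
structure DS (D : Finset (V × V)) : Prop where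
  symm : ∀ u v, (u, v) ∈ D → (v, u) ∈ D
  link : ∀ u v, (u, v) ∈ D → Q.link u v

/-- edge or directed diagonal -/
def X (D : Finset (V × V)) (e : V × V) : Prop := e.2 = Q.nxt e.1 ∨ e ∈ D

variable {Q} {D : Finset (V × V)}

theorem DS.out_le (hD : Q.DS D) {v w : V} (h : Q.X D (v, w)) :
    Q.arc v (Q.nxt v) ≤ Q.arc v w := by
  rcases h with h | h
  · simp only at h; rw [h]
  · exact (hD.link _ _ h).1.1.le

theorem DS.out_lt (hD : Q.DS D) {v w : V} (h : Q.X D (v, w)) :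
    Q.arc v w < Q.arc v (Q.prv v) := by
  rcases h with h | h
  · simp only at h; rw [h]; exact Q.turn' v
  · exact (hD.link _ _ h).1.2

theorem DS.in_le (hD : Q.DS D) {u v : V} (h : Q.X D (u, v)) :
    Q.arc v u ≤ Q.arc v (Q.prv v) := by
  rcases h with h | h
  · simp only at h; rw [h, prv_nxt]
  · exact (hD.link _ _ h).2.2.le

theorem DS.in_lt (hD : Q.DS D) {u v : V} (h : Q.X D (u, v)) :
    Q.arc v (Q.nxt v) < Q.arc v u := by
  rcases h with h | h
  · simp only at h
    have := Q.turn' v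
    rw [h, prv_nxt] at this; rw [h]; exact this
  · exact (hD.link _ _ h).2.1

theorem DS.ne (hD : Q.DS D) {u v : V} (h : Q.X D (u, v)) : u ≠ v := by
  rcases h with h | h
  · simp only at h; rw [h]; exact Q.nxt_ne u
  · exact Q.link_ne (hD.link _ _ h)

/-- an incoming edge which is not the largest is also outgoing -/
theorem DS.rev_in (hD : Q.DS D) {u v : V} (h : Q.X D (u, v))
    (h2 : Q.arc v u < Q.arc v (Q.prv v)) : Q.X D (v, u) := by
  rcases h with h | h
  · simp only at h
    rw [h, prv_nxt] at h2; exact absurd h2 (lt_irrefl _)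
  · exact Or.inr (hD.symm _ _ h)

theorem DS.rev_out (hD : Q.DS D) {u v : V} (h : Q.X D (v, u))
    (h2 : Q.arc v (Q.nxt v) < Q.arc v u) : Q.X D (u, v) := by
  rcases h with h | h
  · simp only at h
    rw [h] at h2; exact absurd h2 (lt_irrefl _)
  · exact Or.inr (hD.symm _ _ h)

variable (Q D)
/-- The relation `f_next a = b`. -/
structure Turn (a b : V × V) : Prop where
  ha : Q.X D a
  hb : Q.X D b
  eq : a.2 = b.1
  lt : Q.arc b.1 b.2 < Q.arc b.1 a.1
  no : ∀ x, Q.X D (b.1, x) → ¬ (Q.arc b.1 b.2 < Q.arc b.1 x ∧ Q.arc b.1 x < Q.arc b.1 a.1)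
variable {Q D}

theorem DS.exists_turn [Fintype V] (hD : Q.DS D) {a : V × V} (ha : Q.X D a) :
    ∃ b, Q.Turn D a b := by
  obtain ⟨u, v⟩ := a
  let C : Finset V := Finset.univ.filter fun w => Q.X D (v, w) ∧ Q.arc v w < Q.arc v u
  have hC : C.Nonempty := ⟨Q.nxt v, by
    simp only [C, Finset.mem_filter, Finset.mem_univ, true_and]
    exact ⟨Or.inl rfl, hD.in_lt ha⟩⟩
  obtain ⟨w, hw, hmax⟩ := C.exists_max_image (Q.arc v) hC
  simp only [C, Finset.mem_filter, Finset.mem_univ, true_and] at hw hmax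
  refine ⟨(v, w), ha, hw.1, rfl, hw.2, ?_⟩
  rintro x hx ⟨h1, h2⟩
  exact absurd (hmax x ⟨hx, h2⟩) (not_le.mpr h1)

theorem Turn.unique {a b c : V × V} (h1 : Q.Turn D a b) (h2 : Q.Turn D a c) : b = c := by
  obtain ⟨v, w⟩ := b
  obtain ⟨v', w'⟩ := c
  obtain ⟨u, v''⟩ := a
  obtain rfl : v'' = v := h1.eq
  obtain rfl : v'' = v' := h2.eq
  congr 1
  apply Q.arc_inj v''
  by_contra hne
  rcases lt_or_gt_of_ne hne with h | h
  · exact h1.no w' h2.hb ⟨h, h2.lt⟩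
  · exact h2.no w h1.hb ⟨h, h1.lt⟩

/-- two angles at the same vertex which overlap are equal -/
theorem DS.overlap (hD : Q.DS D) {a b a' b' : V × V} (h1 : Q.Turn D a b) (h2 : Q.Turn D a' b')
    (hv : a.2 = a'.2) (z : ℝ) (z1 : Q.arc a.2 b.2 < z) (z2 : z < Q.arc a.2 a.1)
    (z3 : Q.arc a.2 b'.2 < z) (z4 : z < Q.arc a.2 a'.1) : a = a' := by
  obtain ⟨v, w⟩ := b
  obtain ⟨v', w'⟩ := b'
  obtain ⟨u, v2⟩ := a
  obtain ⟨u', v3⟩ := a'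
  obtain rfl : v2 = v := h1.eq
  obtain rfl : v3 = v' := h2.eq
  obtain rfl : v2 = v3 := hv
  simp only at *
  congr 1
  apply Q.arc_inj v2
  by_contra hne
  rcases lt_or_gt_of_ne hne with h | h
  · exact h2.no u (hD.rev_in h1.ha (lt_of_lt_of_le h (hD.in_le h2.ha))) ⟨by simp only; linarith, h⟩
  · exact h1.no u' (hD.rev_in h2.ha (lt_of_lt_of_le h (hD.in_le h1.ha))) ⟨by simp only; linarith, h⟩

theorem DS.turn_inj (hD : Q.DS D) {a b c : V × V} (h1 : Q.Turn D a c) (h2 : Q.Turn D b c) :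
    a = b := by
  have e1 := h1.eq
  have e2 := h2.eq
  have l1 := h1.lt
  have l2 := h2.lt
  rw [← e1] at l1 l2
  refine hD.overlap h1 h2 (e1.trans e2.symm)
    ((Q.arc a.2 c.2 + min (Q.arc a.2 a.1) (Q.arc a.2 b.1)) / 2) ?_ ?_ ?_ ?_
  · have := lt_min l1 l2; linarith
  · have := lt_min l1 l2
    have := min_le_left (Q.arc a.2 a.1) (Q.arc a.2 b.1); linarith
  · have := lt_min l1 l2; linarith
  · have := lt_min l1 l2
    have := min_le_right (Q.arc a.2 a.1) (Q.arc a.2 b.1); linarith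

variable [Fintype V]

def Ffun (hD : Q.DS D) (a : V × V) : V × V :=
  if h : Q.X D a then (hD.exists_turn h).choose else a

theorem Ffun_turn (hD : Q.DS D) {a : V × V} (h : Q.X D a) : Q.Turn D a (Ffun hD a) := by
  unfold Ffun; rw [dif_pos h]; exact (hD.exists_turn h).choose_spec

theorem Ffun_inj (hD : Q.DS D) : Function.Injective (Ffun hD) := by
  intro a b h
  by_cases ha : Q.X D a <;> by_cases hb : Q.X D b
  · have h1 := Ffun_turn hD ha
    have h2 := Ffun_turn hD hb
    rw [h] at h1
    exact hD.turn_inj h1 h2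
  · have h1 := (Ffun_turn hD ha).hb
    rw [h, Ffun, dif_neg hb] at h1; exact absurd h1 hb
  · have h1 := (Ffun_turn hD hb).hb
    rw [← h, Ffun, dif_neg ha] at h1; exact absurd h1 ha
  · rwa [Ffun, dif_neg ha, Ffun, dif_neg hb] at h

/-- `f_next` as a permutation -/
def F (hD : Q.DS D) : Equiv.Perm (V × V) :=
  Equiv.ofBijective (Ffun hD) (Finite.injective_iff_bijective.mp (Ffun_inj hD))

theorem F_turn (hD : Q.DS D) {a : V × V} (h : Q.X D a) : Q.Turn D a (F hD a) := Ffun_turn hD h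

theorem F_eq (hD : Q.DS D) {a b : V × V} (h : Q.Turn D a b) : F hD a = b :=
  (F_turn hD h.ha).unique h

theorem F_not (hD : Q.DS D) {a : V × V} (h : ¬ Q.X D a) : F hD a = a := by
  change Ffun hD a = a
  rw [Ffun, dif_neg h]

theorem F_fst (hD : Q.DS D) {a : V × V} (h : Q.X D a) : (F hD a).1 = a.2 := (F_turn hD h).eq.symm

theorem mem_support_F (hD : Q.DS D) (a : V × V) : a ∈ (F hD).support ↔ Q.X D a := by
  rw [Equiv.Perm.mem_support]
  constructor
  · intro h; by_contra h2; exact h (F_not hD h2)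
  · intro h h2
    have := F_fst hD h
    rw [h2] at this
    exact hD.ne (u := a.1) (v := a.2) h this

/-- existence of the angle split by `v` at `u` -/
theorem DS.exists_ang (hD : Q.DS D) {u v : V} (h : Q.spl u v) (hX : ¬ Q.X D (u, v)) :
    ∃ a, Q.X D a ∧ a.2 = u ∧ Q.arc u (F hD a).2 < Q.arc u v ∧ Q.arc u v < Q.arc u a.1 := by
  let C : Finset V := Finset.univ.filter fun y => Q.X D (y, u) ∧ Q.arc u v < Q.arc u y
  have hC : C.Nonempty := ⟨Q.prv u, by
    simp only [C, Finset.mem_filter, Finset.mem_univ, true_and]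
    exact ⟨Or.inl (by simp [nxt_prv]), h.2⟩⟩
  obtain ⟨y, hy, hmin⟩ := C.exists_min_image (Q.arc u) hC
  simp only [C, Finset.mem_filter, Finset.mem_univ, true_and] at hy hmin
  refine ⟨(y, u), hy.1, rfl, ?_, hy.2⟩
  have t := F_turn hD hy.1
  set b := F hD (y, u) with hb
  obtain ⟨u', w⟩ := b
  obtain rfl : u = u' := t.eq
  simp only
  by_contra hlt
  rw [not_lt] at hlt
  have hne : Q.arc u v ≠ Q.arc u w := by
    intro h'
    rw [Q.arc_inj u h'] at hX; exact hX t.hb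
  have hlt' := lt_of_le_of_ne hlt hne
  have := hmin w ⟨hD.rev_out t.hb (h.1.trans hlt'), hlt'⟩
  have := t.lt
  simp only at this
  linarith

end APoly

namespace APoly
variable {V : Type} {Q : APoly V} {D : Finset (V × V)}

def W (Q : APoly V) (e : V × V) : ℝ := 1 / 2 - Q.arc e.1 e.2

set_option linter.unusedSectionVars false
variable [Fintype V]

theorem sum_comp_perm {α : Type} (f : Equiv.Perm α) (Y : Finset α) (h : ∀ a ∈ Y, f a ∈ Y)
    (g : α → ℝ) : ∑ a ∈ Y, g (f a) = ∑ a ∈ Y, g a := by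
  refine Finset.sum_nbij f h f.injective.injOn ?_ (fun _ _ => rfl)
  exact Finset.surjOn_of_injOn_of_card_le f h f.injective.injOn le_rfl

theorem W_sum (hD : Q.DS D) (Y : Finset (V × V)) (hY : ∀ a ∈ Y, Q.X D a)
    (hinv : ∀ a ∈ Y, F hD a ∈ Y) (hne : Y.Nonempty) :
    ∃ n : ℕ, 1 ≤ n ∧ ∑ a ∈ Y, Q.W a = n / 2 := by
  have hpos : 0 < ∑ a ∈ Y, (Q.W a + Q.W (F hD a)) := by
    refine Finset.sum_pos (fun a ha => ?_) hne
    have t := F_turn hD (hY a ha)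
    have l := t.lt
    have e := t.eq
    have := Q.arc_add (hD.ne (u := a.1) (v := a.2) (hY a ha))
    unfold W
    rw [← e] at l ⊢
    linarith
  rw [Finset.sum_add_distrib, sum_comp_perm _ _ hinv] at hpos
  choose z hz using fun e : V × V => Q.arc_int e.1 e.2
  have h1 : ∑ a ∈ Y, Q.φ a.2 = ∑ a ∈ Y, Q.φ a.1 := by
    rw [← sum_comp_perm _ _ hinv (fun a => Q.φ a.1)]
    exact Finset.sum_congr rfl fun a ha => by rw [F_fst hD (hY a ha)]
  have h2 : ∑ a ∈ Y, Q.W a = ((Y.card : ℤ) - 2 * ∑ a ∈ Y, z a : ℤ) / 2 := by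
    unfold W
    simp only [hz, Finset.sum_sub_distrib, Finset.sum_add_distrib, h1]
    push_cast
    simp
    ring
  have h3 : (0 : ℝ) < ((Y.card : ℤ) - 2 * ∑ a ∈ Y, z a : ℤ) := by linarith
  have h4 : 0 < ((Y.card : ℤ) - 2 * ∑ a ∈ Y, z a : ℤ) := by exact_mod_cast h3
  obtain ⟨n, hn⟩ := Int.eq_ofNat_of_zero_le h4.le
  refine ⟨n, by omega, ?_⟩
  rw [h2, hn]; simp

/-- total weight of the polygon -/
def EW (Q : APoly V) : ℝ := ∑ v : V, Q.W (v, Q.nxt v)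

theorem W_swap {u v : V} (h : u ≠ v) : Q.W (v, u) = - Q.W (u, v) := by
  have := Q.arc_add h
  unfold W; simp only; linarith

theorem support_eq (hD : Q.DS D) :
    (F hD).support = (Finset.univ.image fun v => (v, Q.nxt v)) ∪ D := by
  ext ⟨u, v⟩
  rw [mem_support_F]
  simp only [X, Finset.mem_union, Finset.mem_image, Finset.mem_univ, true_and, Prod.mk.injEq]
  constructor
  · rintro (h | h)
    · exact Or.inl ⟨u, rfl, h.symm⟩
    · exact Or.inr h
  · rintro (⟨w, rfl, h⟩ | h)
    · exact Or.inl h.symm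
    · exact Or.inr h

theorem disj_ED (hD : Q.DS D) : Disjoint (Finset.univ.image fun v => (v, Q.nxt v)) D := by
  rw [Finset.disjoint_left]
  intro e he h
  simp only [Finset.mem_image, Finset.mem_univ, true_and] at he
  obtain ⟨v, rfl⟩ := he
  exact lt_irrefl _ (hD.link _ _ h).1.1

theorem sum_support (hD : Q.DS D) : ∑ e ∈ (F hD).support, Q.W e = Q.EW := by
  rw [support_eq, Finset.sum_union (disj_ED hD), Finset.sum_image]
  · have : ∑ e ∈ D, Q.W e = - ∑ e ∈ D, Q.W e := by
      rw [← Finset.sum_neg_distrib]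
      refine Finset.sum_nbij' Prod.swap Prod.swap ?_ ?_ ?_ ?_ ?_
      · rintro ⟨u, v⟩ h; exact hD.symm _ _ h
      · rintro ⟨u, v⟩ h; exact hD.symm _ _ h
      · intros; simp
      · intros; simp
      · rintro ⟨u, v⟩ h
        have := W_swap (Q := Q) (Q.link_ne (hD.link _ _ h))
        simp only [Prod.swap]; linarith
    unfold EW; linarith
  · intro a _ b _ h; exact (Prod.mk.inj h).1

theorem card_support (hD : Q.DS D) : (F hD).support.card = Fintype.card V + D.card := by
  rw [support_eq, Finset.card_union_of_disjoint (disj_ED hD), Finset.card_image_of_injective]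
  · rfl
  · intro a b h; exact (Prod.mk.inj h).1

/-- number of cycles -/
def nc (hD : Q.DS D) : ℕ := (F hD).cycleFactorsFinset.card

theorem cyc_X (hD : Q.DS D) {c : Equiv.Perm (V × V)} (hc : c ∈ (F hD).cycleFactorsFinset)
    {a : V × V} (ha : a ∈ c.support) : Q.X D a :=
  (mem_support_F hD a).mp (Equiv.Perm.mem_cycleFactorsFinset_support_le hc ha)

theorem cyc_eq (hD : Q.DS D) {c : Equiv.Perm (V × V)} (hc : c ∈ (F hD).cycleFactorsFinset)
    {a : V × V} (ha : a ∈ c.support) : c a = F hD a :=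
  (Equiv.Perm.mem_cycleFactorsFinset_iff.mp hc).2 a ha

theorem cyc_inv (hD : Q.DS D) {c : Equiv.Perm (V × V)} (hc : c ∈ (F hD).cycleFactorsFinset)
    {a : V × V} (ha : a ∈ c.support) : F hD a ∈ c.support := by
  rw [← cyc_eq hD hc ha]; exact Equiv.Perm.apply_mem_support.mpr ha

theorem cyc_unique (hD : Q.DS D) {c c' : Equiv.Perm (V × V)}
    (hc : c ∈ (F hD).cycleFactorsFinset) (hc' : c' ∈ (F hD).cycleFactorsFinset)
    {a : V × V} (ha : a ∈ c.support) (ha' : a ∈ c'.support) : c = c' := by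
  rw [Equiv.Perm.cycle_is_cycleOf ha hc, Equiv.Perm.cycle_is_cycleOf ha' hc']

theorem cyc_exists (hD : Q.DS D) {a : V × V} (ha : Q.X D a) :
    ∃ c ∈ (F hD).cycleFactorsFinset, a ∈ c.support :=
  Equiv.Perm.mem_support_iff_mem_support_of_mem_cycleFactorsFinset.mp
    ((mem_support_F hD a).mpr ha)

theorem cyc_sum (hD : Q.DS D) :
    ∑ c ∈ (F hD).cycleFactorsFinset, ∑ e ∈ c.support, Q.W e = Q.EW := by
  rw [← sum_support hD, ← Finset.sum_biUnion]
  · congr 1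
    ext a
    rw [Finset.mem_biUnion]
    exact Equiv.Perm.mem_support_iff_mem_support_of_mem_cycleFactorsFinset.symm
  · intro c hc c' hc' hne
    rw [Function.onFun, Finset.disjoint_left]
    intro a ha ha'
    exact hne (cyc_unique hD hc hc' ha ha')

theorem cyc_ge (hD : Q.DS D) {c : Equiv.Perm (V × V)} (hc : c ∈ (F hD).cycleFactorsFinset) :
    (1 / 2 : ℝ) ≤ ∑ e ∈ c.support, Q.W e := by
  obtain ⟨n, hn, h⟩ := W_sum hD c.support (fun a => cyc_X hD hc) (fun a => cyc_inv hD hc)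
    (Equiv.Perm.mem_cycleFactorsFinset_iff.mp hc).1.nonempty_support
  rw [h]
  have : (1 : ℝ) ≤ n := by exact_mod_cast hn
  linarith

theorem nc_le (hD : Q.DS D) : (nc hD : ℝ) / 2 ≤ Q.EW := by
  rw [← cyc_sum hD, nc]
  calc _ = ∑ c ∈ (F hD).cycleFactorsFinset, (1 / 2 : ℝ) := by simp; ring
    _ ≤ _ := Finset.sum_le_sum fun c hc => cyc_ge hD hc

theorem cyc_half (hD : Q.DS D) (h : (nc hD : ℝ) / 2 = Q.EW) {c : Equiv.Perm (V × V)}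
    (hc : c ∈ (F hD).cycleFactorsFinset) : ∑ e ∈ c.support, Q.W e = 1 / 2 := by
  rw [← cyc_sum hD, nc] at h
  have h2 : ∑ c ∈ (F hD).cycleFactorsFinset, (1 / 2 : ℝ) =
      ∑ c ∈ (F hD).cycleFactorsFinset, ∑ e ∈ c.support, Q.W e := by
    rw [← h]; simp; ring
  exact ((Finset.sum_eq_sum_iff_of_le (fun c hc => cyc_ge hD hc)).mp h2 c hc).symm

theorem nc_parity (hD : Q.DS D) :
    Equiv.Perm.sign (F hD) = (-1) ^ (Fintype.card V + D.card + nc hD) := by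
  rw [Equiv.Perm.sign_of_cycleType, Equiv.Perm.sum_cycleType, card_support]
  congr 2
  rw [Equiv.Perm.cycleType_def, Multiset.card_map]; rfl

/-- the angle data of a diagonal candidate -/
structure Ang (hD : Q.DS D) (u v : V) (a : V × V) : Prop where
  hX : Q.X D a
  eq : a.2 = u
  lo : Q.arc u (F hD a).2 < Q.arc u v
  hi : Q.arc u v < Q.arc u a.1

theorem exists_Ang (hD : Q.DS D) {u v : V} (h : Q.link u v) (hX : (u, v) ∉ D) :
    ∃ a, Ang hD u v a := by
  obtain ⟨a, h1, h2, h3, h4⟩ := hD.exists_ang h.1 (by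
    rintro (h' | h')
    · simp only at h'
      rw [h'] at h; exact lt_irrefl _ h.1.1
    · exact hX h')
  exact ⟨a, h1, h2, h3, h4⟩

theorem Ang.unique {hD : Q.DS D} {u v : V} {a b : V × V} (h1 : Ang hD u v a) (h2 : Ang hD u v b) :
    a = b := by
  obtain ⟨a1, a2⟩ := a
  obtain ⟨b1, b2⟩ := b
  obtain rfl : a2 = u := h1.eq
  obtain rfl : b2 = a2 := h2.eq
  exact hD.overlap (F_turn hD h1.hX) (F_turn hD h2.hX) rfl _ h1.lo h1.hi h2.lo h2.hi

/-- adding the diagonal `uv` -/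
def addDiag (D : Finset (V × V)) (u v : V) : Finset (V × V) := D ∪ {(u, v), (v, u)}

theorem mem_add {u v : V} {e : V × V} : e ∈ addDiag D u v ↔ e ∈ D ∨ e = (u, v) ∨ e = (v, u) := by
  simp [addDiag]; tauto

theorem DS.add (hD : Q.DS D) {u v : V} (h : Q.link u v) : Q.DS (addDiag D u v) := by
  constructor
  · intro x y hxy
    rw [mem_add] at hxy ⊢
    rcases hxy with h' | h' | h'
    · exact Or.inl (hD.symm _ _ h')
    · simp only [Prod.mk.injEq] at h'; right; right; simp [h']
    · simp only [Prod.mk.injEq] at h'; right; left; simp [h']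
  · intro x y hxy
    rw [mem_add] at hxy
    rcases hxy with h' | h' | h'
    · exact hD.link _ _ h'
    · simp only [Prod.mk.injEq] at h'; rw [h'.1, h'.2]; exact h
    · simp only [Prod.mk.injEq] at h'; rw [h'.1, h'.2]; exact Q.link_symm h

theorem X_mono {D' : Finset (V × V)} (h : D ⊆ D') {e : V × V} (he : Q.X D e) : Q.X D' e :=
  he.imp id (fun h' => h h')

theorem F_persist {D' : Finset (V × V)} (hD : Q.DS D) (hD' : Q.DS D') (hsub : D ⊆ D')
    {a : V × V} (ha : Q.X D a)
    (hno : ∀ x, (a.2, x) ∈ D' → (a.2, x) ∉ D → ¬ Ang hD a.2 x a) : F hD' a = F hD a := by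
  have t := F_turn hD ha
  apply F_eq
  refine ⟨X_mono hsub ha, X_mono hsub t.hb, t.eq, t.lt, ?_⟩
  rintro x hx ⟨h1, h2⟩
  by_cases hxD : Q.X D ((F hD a).1, x)
  · exact t.no x hxD ⟨h1, h2⟩
  · rw [← t.eq] at hx h1 h2 hxD
    have hx' : (a.2, x) ∈ D' := by
      rcases hx with h | h
      · exact absurd (Or.inl h) hxD
      · exact h
    exact hno x hx' (fun h => hxD (Or.inr h)) ⟨ha, rfl, h1, h2⟩

theorem card_add {u v : V} (h : Q.link u v) (hsym : Q.DS D) (hn : (u, v) ∉ D) :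
    (APoly.addDiag D u v).card = D.card + 2 := by
  have hne := Q.link_ne h
  unfold APoly.addDiag
  rw [Finset.card_union_of_disjoint, Finset.card_pair]
  · simp [hne]
  · rw [Finset.disjoint_right]
    intro e he h'
    simp only [Finset.mem_insert, Finset.mem_singleton] at he
    rcases he with rfl | rfl
    · exact hn h'
    · exact hn (hsym.symm _ _ h')

theorem add_step (hD : Q.DS D) {u v : V} (h : Q.link u v) (hD' : Q.DS (APoly.addDiag D u v))
    (hn : (u, v) ∉ D) {a : V × V} (ha : Ang hD u v a) :
    F hD' a = (u, v) ∧ F hD' (v, u) = F hD a := by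
  have t := F_turn hD ha.hX
  have hsub : D ⊆ APoly.addDiag D u v := fun e he => mem_add.mpr (Or.inl he)
  have hne := Q.link_ne h
  have key : ∀ x, Q.X (APoly.addDiag D u v) (u, x) → Q.X D (u, x) ∨ x = v := by
    rintro x (hx | hx)
    · exact Or.inl (Or.inl hx)
    · rw [mem_add] at hx
      rcases hx with hx | hx | hx
      · exact Or.inl (Or.inr hx)
      · right; exact (Prod.mk.inj hx).2
      · exact absurd (Prod.mk.inj hx).1 hne
  have e := t.eq
  have ee : (F hD a).1 = u := by rw [← e, ha.eq]
  constructor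
  · apply F_eq
    refine ⟨X_mono hsub ha.hX, Or.inr (mem_add.mpr (by simp)), ha.eq, ha.hi, ?_⟩
    rintro x hx ⟨h1, h2⟩
    simp only at h1 h2 hx
    rcases key x hx with hx | rfl
    · exact t.no x (by rw [ee]; exact hx) (by rw [ee]; exact ⟨ha.lo.trans h1, h2⟩)
    · exact lt_irrefl _ h1
  · apply F_eq
    refine ⟨Or.inr (mem_add.mpr (by simp)), X_mono hsub t.hb, ee.symm, ?_, ?_⟩
    · simp only; rw [ee]; exact ha.lo
    · rw [ee]
      rintro x hx ⟨h1, h2⟩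
      simp only at h1 h2 hx
      rcases key x hx with hx | rfl
      · exact t.no x (by rw [ee]; exact hx) (by rw [ee]; exact ⟨h1, h2.trans ha.hi⟩)
      · exact lt_irrefl _ h2

theorem add_comm' (u v : V) : APoly.addDiag D u v = APoly.addDiag D v u := by
  ext e; rw [mem_add, mem_add]; tauto

theorem sign_add (hD : Q.DS D) {u v : V} (h : Q.link u v) (hD' : Q.DS (APoly.addDiag D u v))
    (hn : (u, v) ∉ D) :
    Equiv.Perm.sign (F hD') = - Equiv.Perm.sign (F hD) := by
  have hn' : (v, u) ∉ D := fun h' => hn (hD.symm _ _ h')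
  obtain ⟨x, hx⟩ := exists_Ang hD h hn
  obtain ⟨y, hy⟩ := exists_Ang hD (Q.link_symm h) hn'
  have hne := Q.link_ne h
  have s1 := add_step hD h hD' hn hx
  have s2 : F hD' y = (v, u) ∧ F hD' (u, v) = F hD y := by
    have hD'' : Q.DS (APoly.addDiag D v u) := by rw [add_comm']; exact hD'
    have := add_step hD (Q.link_symm h) hD'' hn' hy
    have e : ∀ z, F hD'' z = F hD' z := by
      intro z; congr 2
      rw [add_comm']
    rwa [e, e] at this
  have nX : ¬ Q.X D (u, v) := by
    rintro (h' | h')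
    · simp only at h'; rw [h'] at h; exact lt_irrefl _ h.1.1
    · exact hn h'
  have nX' : ¬ Q.X D (v, u) := by
    rintro (h' | h')
    · simp only at h'; rw [h'] at h; exact lt_irrefl _ h.2.1
    · exact hn' h'
  have x_e : x ≠ (u, v) := fun h' => nX (h' ▸ hx.hX)
  have x_e' : x ≠ (v, u) := fun h' => nX' (h' ▸ hx.hX)
  have y_e : y ≠ (u, v) := fun h' => nX (h' ▸ hy.hX)
  have y_e' : y ≠ (v, u) := fun h' => nX' (h' ▸ hy.hX)
  have xy : x ≠ y := by
    rintro rfl; exact hne (hx.eq.symm.trans hy.eq)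
  have ee : ((u, v) : V × V) ≠ (v, u) := fun h' => hne (Prod.mk.inj h').1
  have hF : F hD' = F hD * (Equiv.swap x (v, u) * (Equiv.swap x y * Equiv.swap x (u, v))) := by
    ext1 z
    simp only [Equiv.Perm.mul_apply]
    by_cases z1 : z = x
    · subst z1
      rw [Equiv.swap_apply_left, Equiv.swap_apply_of_ne_of_ne x_e.symm y_e.symm,
        Equiv.swap_apply_of_ne_of_ne x_e.symm ee, s1.1, F_not hD nX]
    by_cases z2 : z = (u, v)
    · subst z2
      rw [Equiv.swap_apply_right, Equiv.swap_apply_left, Equiv.swap_apply_of_ne_of_ne xy.symm y_e',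
        s2.2]
    by_cases z3 : z = y
    · subst z3
      rw [Equiv.swap_apply_of_ne_of_ne z1 z2, Equiv.swap_apply_right, Equiv.swap_apply_left, s2.1,
        F_not hD nX']
    by_cases z4 : z = (v, u)
    · subst z4
      rw [Equiv.swap_apply_of_ne_of_ne z1 z2, Equiv.swap_apply_of_ne_of_ne z1 z3,
        Equiv.swap_apply_right, s1.2]
    rw [Equiv.swap_apply_of_ne_of_ne z1 z2, Equiv.swap_apply_of_ne_of_ne z1 z3,
      Equiv.swap_apply_of_ne_of_ne z1 z4]
    have hsub : D ⊆ APoly.addDiag D u v := fun e he => mem_add.mpr (Or.inl he)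
    by_cases hz : Q.X D z
    · apply F_persist hD hD' hsub hz
      intro w hw hw' hang
      rw [mem_add] at hw
      rcases hw with hw | hw | hw
      · exact hw' hw
      · obtain ⟨r1, r2⟩ := Prod.mk.inj hw
        rw [r1, r2] at hang; exact z1 (hang.unique hx)
      · obtain ⟨r1, r2⟩ := Prod.mk.inj hw
        rw [r1, r2] at hang; exact z3 (hang.unique hy)
    · rw [F_not hD hz, F_not]
      rintro (h' | h')
      · exact hz (Or.inl h')
      · rw [mem_add] at h'
        rcases h' with h' | h' | h'
        · exact hz (Or.inr h')
        · exact z2 h'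
        · exact z4 h'
  rw [hF, Equiv.Perm.sign_mul, Equiv.Perm.sign_mul, Equiv.Perm.sign_mul,
    Equiv.Perm.sign_swap x_e', Equiv.Perm.sign_swap xy, Equiv.Perm.sign_swap x_e]
  simp

theorem parity_add (hD : Q.DS D) {u v : V} (h : Q.link u v) (hD' : Q.DS (APoly.addDiag D u v))
    (hn : (u, v) ∉ D) : (nc hD' + nc hD) % 2 = 1 := by
  have h1 := sign_add hD h hD' hn
  rw [nc_parity, nc_parity, card_add h hD hn] at h1
  have h2 : ((-1 : ℤˣ)) ^ (nc hD') = - (-1) ^ (nc hD) := by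
    have e : (-1 : ℤˣ) ^ (Fintype.card V + (D.card + 2) + nc hD') =
        (-1) ^ (Fintype.card V + D.card) * (-1) ^ (nc hD') := by
      rw [pow_add, ← add_assoc, pow_add _ _ 2]; simp
    rw [e, pow_add _ (Fintype.card V + D.card) (nc hD), ← mul_neg] at h1
    exact mul_left_cancel h1
  rcases Nat.even_or_odd (nc hD) with a | a <;> rcases Nat.even_or_odd (nc hD') with b | b
  · rw [a.neg_one_pow, b.neg_one_pow] at h2; exact absurd h2 (by decide)
  · rw [Nat.even_iff] at a; rw [Nat.odd_iff] at b; omega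
  · rw [Nat.odd_iff] at a; rw [Nat.even_iff] at b; omega
  · rw [a.neg_one_pow, b.neg_one_pow] at h2; exact absurd h2 (by decide)

/-- lower bound on the number of cycles after adding diagonals: all cycles outside `B` persist,
and there is at least one other cycle. -/
theorem nc_ge {D' : Finset (V × V)} (hD : Q.DS D) (hD' : Q.DS D') (hsub : D ⊂ D')
    (B : Finset (Equiv.Perm (V × V)))
    (hno : ∀ u v, (u, v) ∈ D' → (u, v) ∉ D → ∀ a, Ang hD u v a → ∃ c ∈ B, a ∈ c.support)
    (hB : B ⊆ (F hD).cycleFactorsFinset) : nc hD + 1 ≤ nc hD' + B.card := by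
  obtain ⟨e, he, he'⟩ := Finset.exists_of_ssubset hsub
  obtain ⟨c0, hc0, hec⟩ := cyc_exists hD' (a := e) (Or.inr he)
  have h1 : insert c0 ((F hD).cycleFactorsFinset \ B) ⊆ (F hD').cycleFactorsFinset := by
    intro c hc
    rw [Finset.mem_insert, Finset.mem_sdiff] at hc
    rcases hc with rfl | ⟨hc, hcB⟩
    · exact hc0
    · rw [Equiv.Perm.mem_cycleFactorsFinset_iff]
      refine ⟨(Equiv.Perm.mem_cycleFactorsFinset_iff.mp hc).1, fun a ha => ?_⟩
      rw [cyc_eq hD hc ha]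
      symm
      apply F_persist hD hD' hsub.subset (cyc_X hD hc ha)
      intro x hx hx' hang
      obtain ⟨c', hc', hac'⟩ := hno _ _ hx hx' _ hang
      rw [cyc_unique hD hc (hB hc') ha hac'] at hcB
      exact hcB hc'
  have h2 : c0 ∉ (F hD).cycleFactorsFinset \ B := by
    intro h
    have := cyc_X hD (Finset.mem_sdiff.mp h).1 hec
    rcases this with h' | h'
    · have := (hD'.link e.1 e.2 he).1.1
      rw [h'] at this; exact lt_irrefl _ this
    · exact he' h'
  have h3 := Finset.card_le_card h1
  rw [Finset.card_insert_of_notMem h2, Finset.card_sdiff_of_subset hB] at h3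
  have := Finset.card_le_card hB
  unfold nc
  omega

end APoly

namespace APoly
set_option linter.unusedSectionVars false
variable {V : Type} {Q : APoly V} {D : Finset (V × V)} [Fintype V]

structure StarSeq (hD : Q.DS D) (c : Equiv.Perm (V × V)) (k : ℕ) (a : ℕ → ℝ) (s : ℕ → V) :
    Prop where
  kpos : 1 ≤ k
  mono : StrictMono a
  per : ∀ j, a (j + (2 * k + 1)) = a j + 1
  int : ∀ j, ∃ z : ℤ, a j = z - Q.φ (s j)
  edge : ∀ j, (s (j + k), s j) ∈ c.support
  nxt : ∀ j, F hD (s (j + k), s j) = (s j, s (j + k + 1))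
  all : ∀ e ∈ c.support, ∃ j, e = (s (j + k), s j)
  card : c.support.card = 2 * k + 1

theorem exists_starSeq (hD : Q.DS D) {c : Equiv.Perm (V × V)}
    (hc : c ∈ (F hD).cycleFactorsFinset) (hW : ∑ e ∈ c.support, Q.W e = 1 / 2) :
    ∃ k a s, StarSeq hD c k a s := by
  have hcyc := (Equiv.Perm.mem_cycleFactorsFinset_iff.mp hc).1
  obtain ⟨e0, he0⟩ := hcyc.nonempty_support
  set L := c.support.card with hL
  have hLpos : 0 < L := Finset.card_pos.mpr ⟨e0, he0⟩
  let ε : ℕ → V × V := fun i => (c ^ i) e0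
  have εmem : ∀ i, ε i ∈ c.support := fun i => Equiv.Perm.pow_apply_mem_support.mpr he0
  have εper : ∀ i, ε (i + L) = ε i := by
    intro i
    have : c ^ L = 1 := by rw [hL, ← hcyc.orderOf]; exact pow_orderOf_eq_one c
    simp only [ε]
    rw [pow_add, this, mul_one]
  have εper2 : ∀ m i, ε (i + m * L) = ε i := by
    intro m
    induction m with
    | zero => simp
    | succ m ih => intro i; rw [Nat.succ_mul, ← add_assoc, εper, ih]
  have εsucc : ∀ i, ε (i + 1) = F hD (ε i) := by
    intro i
    rw [← cyc_eq hD hc (εmem i)]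
    simp only [ε]
    rw [pow_succ', Equiv.Perm.mul_apply]
  have εall : ∀ e ∈ c.support, ∃ i, ε i = e := fun e he =>
    hcyc.exists_pow_eq (Equiv.Perm.mem_support.mp he0) (Equiv.Perm.mem_support.mp he)
  have himg : (Finset.range L).image ε = c.support := by
    ext e
    simp only [Finset.mem_image, Finset.mem_range]
    constructor
    · rintro ⟨i, _, rfl⟩; exact εmem i
    · intro he
      obtain ⟨i, rfl⟩ := εall e he
      refine ⟨i % L, Nat.mod_lt _ hLpos, ?_⟩
      conv_rhs => rw [← Nat.mod_add_div i L, mul_comm, εper2]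
  have hsum : ∑ i ∈ Finset.range L, Q.W (ε i) = 1 / 2 := by
    rw [← hW, ← himg, Finset.sum_image]
    apply Finset.injOn_of_card_image_eq
    rw [himg, Finset.card_range]
  let p : ℕ → V := fun i => (ε i).1
  have ε2 : ∀ i, (ε i).2 = p (i + 1) := by
    intro i
    simp only [p]
    rw [εsucc, F_fst hD (cyc_X hD hc (εmem i))]
  have εeq : ∀ i, ε i = (p i, p (i + 1)) := fun i => Prod.ext rfl (ε2 i)
  have pper : ∀ i, p (i + L) = p i := fun i => by simp only [p]; rw [εper]
  let δ : ℕ → ℝ := fun i => Q.arc (p i) (p (i + 1))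
  have hδ : ∀ i, δ i + δ (i + 1) < 1 := by
    intro i
    have hX := cyc_X hD hc (εmem i)
    have t := F_turn hD hX
    have l := t.lt
    rw [← εsucc, εeq (i + 1), εeq i] at l
    rw [εeq i] at hX
    have := Q.arc_add (hD.ne hX)
    simp only [δ] at l ⊢
    linarith
  let θ : ℕ → ℝ := fun i => Q.φ (p 0) + ∑ j ∈ Finset.range i, δ j
  have θs : ∀ i, θ (i + 1) = θ i + δ i := by
    intro i; simp only [θ]; rw [Finset.sum_range_succ]; ring
  have θint : ∀ i, ∃ z : ℤ, θ i = Q.φ (p i) + z := by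
    intro i
    induction i with
    | zero => exact ⟨0, by simp [θ]⟩
    | succ i ih =>
      obtain ⟨z, hz⟩ := ih
      obtain ⟨w, hw⟩ := Q.arc_int (p i) (p (i + 1))
      refine ⟨z + w, ?_⟩
      rw [θs, hz]; simp only [δ]; rw [hw]; push_cast; ring
  have hsumδ : ∑ j ∈ Finset.range L, δ j = ((L : ℝ) - 1) / 2 := by
    have : ∑ i ∈ Finset.range L, Q.W (ε i) = ∑ i ∈ Finset.range L, (1 / 2 - δ i) := by
      apply Finset.sum_congr rfl
      intro i _
      rw [εeq]; rfl
    rw [this, Finset.sum_sub_distrib] at hsum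
    simp at hsum
    linarith
  have θper : ∀ i, θ (i + L) = θ i + ((L : ℝ) - 1) / 2 := by
    intro i
    induction i with
    | zero => rw [zero_add]; simp only [θ]; rw [hsumδ]; simp
    | succ i ih =>
      rw [show i + 1 + L = (i + L) + 1 by ring, θs, θs, ih]
      have : δ (i + L) = δ i := by
        simp only [δ]
        rw [pper, show i + L + 1 = (i + 1) + L by ring, pper]
      rw [this]; ring
  obtain ⟨k, hk⟩ : ∃ k : ℕ, L = 2 * k + 1 := by
    obtain ⟨z, hz⟩ := θint L
    obtain ⟨w, hw⟩ := θint 0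
    have h1 := θper 0
    have h2 := pper 0
    rw [zero_add] at h1 h2
    rw [h2] at hz
    have : ((L : ℤ) : ℝ) = ((2 * (z - w) + 1 : ℤ) : ℝ) := by push_cast; linarith
    have : (L : ℤ) = 2 * (z - w) + 1 := by exact_mod_cast this
    exact ⟨(z - w).toNat, by omega⟩
  have hkR : (L : ℝ) = 2 * k + 1 := by rw [hk]; push_cast; ring
  refine ⟨k, fun j => j - θ (2 * j), fun j => p (2 * j), ?_, ?_, ?_, ?_, ?_, ?_, ?_, hk⟩
  · by_contra hk0
    have hL1 : L = 1 := by omega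
    have h1 := pper 0
    rw [hL1, zero_add] at h1
    have h2 := cyc_X hD hc (εmem 0)
    rw [εeq, zero_add] at h2
    exact hD.ne h2 h1.symm
  · apply strictMono_nat_of_lt_succ
    intro j
    have h1 := θs (2 * j)
    have h2 := θs (2 * j + 1)
    have h3 := hδ (2 * j)
    have e : 2 * (j + 1) = 2 * j + 1 + 1 := by ring
    rw [e]; push_cast; linarith
  · intro j
    have e : 2 * (j + (2 * k + 1)) = 2 * j + L + L := by rw [hk]; ring
    rw [e, θper, θper, hkR]; push_cast; ring
  · intro j
    obtain ⟨z, hz⟩ := θint (2 * j)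
    refine ⟨j - z, ?_⟩
    rw [hz]; push_cast; ring
  · intro j
    have : ((p (2 * (j + k)), p (2 * j)) : V × V) = ε (2 * (j + k)) := by
      rw [εeq, ← pper (2 * j), hk]; congr 2; ring
    rw [this]; exact εmem _
  · intro j
    have h1 : ((p (2 * (j + k)), p (2 * j)) : V × V) = ε (2 * (j + k)) := by
      rw [εeq, ← pper (2 * j), hk]; congr 2; ring
    have h2 : ((p (2 * j), p (2 * (j + k + 1))) : V × V) = ε (2 * (j + k) + 1) := by
      rw [εeq, ← pper (2 * j), hk]; congr 2; ring
    rw [h1, h2, εsucc]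
  · intro e he
    obtain ⟨i, rfl⟩ := εall e he
    have h1 : ∀ j, ((p (2 * (j + k)), p (2 * j)) : V × V) = ε (2 * (j + k)) := by
      intro j
      rw [εeq, ← pper (2 * j), hk]; congr 2; ring
    rcases Nat.even_or_odd' i with ⟨m, hm | hm⟩
    · refine ⟨m + k + 1, ?_⟩
      rw [h1, ← εper2 2 i, hm, hk]; congr 1; ring
    · refine ⟨m + 2 * k + 2 + k - k, ?_⟩
      rw [h1, ← εper2 3 i, hm, hk]; congr 1; omega

theorem StarSeq.arc_eq {hD : Q.DS D} {c c' : Equiv.Perm (V × V)} {k k' : ℕ} {a a' : ℕ → ℝ}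
    {s s' : ℕ → V} (h : StarSeq hD c k a s) (h' : StarSeq hD c' k' a' s') {i j : ℕ} {y : ℝ}
    (w : ℤ) (hy : y = a' j + w)
    (h1 : a i < y) (h2 : y < a i + 1) : Q.arc (s i) (s' j) = 1 - (y - a i) := by
  obtain ⟨z, hz⟩ := h.int i
  obtain ⟨z', hz'⟩ := h'.int j
  apply Q.arc_eq_of (by linarith) (by linarith) (1 + z - z' - w)
  push_cast; linarith

theorem StarSeq.arc_prv {hD : Q.DS D} {c : Equiv.Perm (V × V)} {k : ℕ} {a : ℕ → ℝ}
    {s : ℕ → V} (h : StarSeq hD c k a s) (j : ℕ) :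
    Q.arc (s j) (s (j + k)) = 1 - (a (j + k) - a j) := by
  apply h.arc_eq h 0 (by simp)
  · apply h.mono; have := h.kpos; omega
  · rw [← h.per]; apply h.mono; omega

theorem StarSeq.arc_nxt {hD : Q.DS D} {c : Equiv.Perm (V × V)} {k : ℕ} {a : ℕ → ℝ}
    {s : ℕ → V} (h : StarSeq hD c k a s) (j : ℕ) :
    Q.arc (s j) (s (j + k + 1)) = 1 - (a (j + k + 1) - a j) := by
  apply h.arc_eq h 0 (by simp)
  · apply h.mono; omega
  · rw [← h.per]; apply h.mono; have := h.kpos; omega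

/-- Discrete common bisector lemma. -/
theorem seq_bisector (k l : ℕ) (hk : 1 ≤ k) (a b : ℕ → ℝ) (ha : StrictMono a) (hb : StrictMono b)
    (pa : ∀ j, a (j + (2 * k + 1)) = a j + 1) (pb : ∀ j, b (j + (2 * l + 1)) = b j + 1) :
    ∃ i j, b i < a j ∧ a j ≤ b (i + 1) ∧ a (j + k) ≤ b (i + l + 1) ∧
      b (i + l + 1) < a (j + k + 1) := by
  have grow : ∀ (f : ℕ → ℝ) (N : ℕ), (∀ j, f (j + N) = f j + 1) → ∀ x, ∃ n, x < f n := by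
    intro f N hf x
    have hm : ∀ m : ℕ, f (m * N) = f 0 + m := by
      intro m
      induction m with
      | zero => simp
      | succ m ih => rw [Nat.succ_mul, hf, ih]; push_cast; ring
    obtain ⟨m, hm'⟩ := exists_nat_gt (x - f 0)
    exact ⟨m * N, by rw [hm]; linarith⟩
  obtain ⟨j0, hj0⟩ := grow a _ pa (b 0)
  have exc : ∀ j, ∃ i, j0 ≤ j → b i < a j ∧ a j ≤ b (i + 1) := by
    intro j
    by_cases hj : j0 ≤ j
    · have hex : ∃ n, a j ≤ b n := (grow b _ pb (a j)).imp fun n hn => hn.le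
      have h0 : Nat.find hex ≠ 0 := by
        intro h
        have := Nat.find_spec hex
        rw [h] at this
        have := ha.monotone hj
        linarith
      obtain ⟨m, hm⟩ := Nat.exists_eq_succ_of_ne_zero h0
      refine ⟨m, fun _ => ⟨?_, ?_⟩⟩
      · have := Nat.find_min hex (m := m) (by omega)
        exact not_le.mp this
      · have := Nat.find_spec hex
        rwa [hm] at this
    · exact ⟨0, fun h => absurd h hj⟩
  choose c hc using exc
  by_contra hno
  push Not at hno
  have hAB : ∀ j, j0 ≤ j → b (c j + l + 1) < a (j + k) ∨ a (j + k + 1) ≤ b (c j + l + 1) := by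
    intro j hj
    by_cases h : a (j + k) ≤ b (c j + l + 1)
    · exact Or.inr (hno (c j) j (hc j hj).1 (hc j hj).2 h)
    · exact Or.inl (not_le.mp h)
  have cmono : ∀ i j, j0 ≤ i → i ≤ j → c i ≤ c j := by
    intro i j hi hij
    have h1 := (hc i hi).1
    have h2 := (hc j (hi.trans hij)).2
    have h3 := ha.monotone hij
    have : b (c i) < b (c j + 1) := by linarith
    have := hb.lt_iff_lt.mp this
    omega
  by_cases hA : ∃ j, j0 ≤ j ∧ a (j + k + 1) ≤ b (c j + l + 1)
  · obtain ⟨j, hj, hAj⟩ := hA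
    have all : ∀ n, a (j + n + k + 1) ≤ b (c (j + n) + l + 1) := by
      intro n
      induction n with
      | zero => exact hAj
      | succ n ih =>
        rcases hAB (j + (n + 1)) (by omega) with h | h
        · have h1 := cmono (j + n) (j + (n + 1)) (by omega) (by omega)
          have h2 : b (c (j + n) + l + 1) ≤ b (c (j + (n + 1)) + l + 1) := hb.monotone (by omega)
          have e : j + (n + 1) + k = j + n + k + 1 := by ring
          rw [e] at h
          linarith
        · exact h
    have h1 := all (k + 1)
    have h2 := hc (j + (k + 1)) (by omega)
    have h3 : c (j + (k + 1)) < c j + l + 1 := by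
      apply hb.lt_iff_lt.mp
      have e : j + (k + 1) = j + k + 1 := by ring
      rw [e] at h2 ⊢
      linarith
    have h4 : b (c (j + (k + 1)) + l + 1) ≤ b (c j + (2 * l + 1)) := hb.monotone (by omega)
    rw [pb] at h4
    have h5 := (hc j hj).1
    have h6 : a (j + (k + 1) + k + 1) = a (j + 1) + 1 := by
      rw [← pa]; congr 1; ring
    have h7 : a j < a (j + 1) := ha (by omega)
    linarith
  · push Not at hA
    have hB : ∀ j, j0 ≤ j → b (c j + l + 1) < a (j + k) := by
      intro j hj
      rcases hAB j hj with h | h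
      · exact h
      · exact absurd h (not_le.mpr (hA j hj))
    set j := j0 + 1 with hjdef
    have hj : j0 ≤ j := by omega
    have h1 := hB j hj
    have h2 := hB (j + k) (by omega)
    have h3 : c j + l + 1 < c (j + k) + 1 := by
      apply hb.lt_iff_lt.mp
      have := (hc (j + k) (by omega)).2
      linarith
    have h4 : b (c j + 1 + (2 * l + 1)) ≤ b (c (j + k) + l + 1) := hb.monotone (by omega)
    rw [pb] at h4
    have h5 := (hc j hj).2
    have h6 : a (j + k + k) = a j0 + 1 := by
      rw [← pa]; congr 1; omega
    have h7 : a j0 < a j := ha (by omega)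
    linarith

theorem common_bisector (hD : Q.DS D) {c c' : Equiv.Perm (V × V)}
    (hc : c ∈ (F hD).cycleFactorsFinset) (hc' : c' ∈ (F hD).cycleFactorsFinset) (hne : c ≠ c')
    (hW : ∑ e ∈ c.support, Q.W e = 1 / 2) (hW' : ∑ e ∈ c'.support, Q.W e = 1 / 2) :
    ∃ u v x y, x ∈ c.support ∧ y ∈ c'.support ∧ Ang hD u v x ∧ Ang hD v u y := by
  obtain ⟨k, a, s, S⟩ := exists_starSeq hD hc hW
  obtain ⟨l, b, t, T⟩ := exists_starSeq hD hc' hW'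
  obtain ⟨i, j, h1, h2, h3, h4⟩ := seq_bisector k l S.kpos a b S.mono T.mono S.per T.per
  set m := i + l + 1 with hm
  -- the points are `u = s j`, `v = t m`
  have Xs := cyc_X hD hc (S.edge j)
  have Xt := cyc_X hD hc' (T.edge m)
  have ek : a j < a (j + k) := S.mono (by have := S.kpos; omega)
  have ek2 : a (j + k + 1) < a j + 1 := by
    rw [← S.per]; apply S.mono; have := S.kpos; omega
  have bm1 : b (m + l) = b i + 1 := by rw [← T.per]; congr 1; omega
  have bm2 : b (m + l + 1) = b (i + 1) + 1 := by rw [← T.per]; congr 1; omega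
  have bm3 : b m < b (m + l) := T.mono (by have := T.kpos; omega)
  have bm4 : b (m + l + 1) < b m + 1 := by
    rw [← T.per]; apply T.mono; have := T.kpos; omega
  have A1 : Q.arc (s j) (t m) = 1 - (b m - a j) :=
    S.arc_eq T 0 (by simp) (by linarith) (by linarith)
  have A2 := S.arc_prv j
  have A3 := S.arc_nxt j
  have B1 : Q.arc (t m) (s j) = 1 - (a j + 1 - b m) :=
    T.arc_eq S 1 (by simp) (by linarith) (by linarith)
  have B2 := T.arc_prv m
  have B3 := T.arc_nxt m
  have N1 := S.nxt j
  have N2 := T.nxt m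
  -- exclude equality in the first
  have eA : a (j + k) ≠ b m := by
    intro h
    have e : s (j + k) = t m := by
      apply Q.arc_inj (s j); rw [A1, A2, h]
    rcases eq_or_lt_of_le h2 with h5 | h5
    · -- shared edge
      have e2 : t (m + l + 1) = s j := by
        apply Q.arc_inj (t m); rw [B1, B3, bm2, h5]
      have h6 := cyc_inv hD hc' (T.edge m)
      rw [N2, e2, ← e] at h6
      exact hne (cyc_unique hD hc hc' (S.edge j) h6)
    · -- overlap at `t m`
      have Tn := F_turn hD Xt
      have i1 := S.edge (j + k)
      have Sn := F_turn hD (cyc_X hD hc i1)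
      have N3 := S.nxt (j + k)
      have e3 : s (j + k + k + 1) = s j := by
        apply Q.inj
        obtain ⟨z, hz⟩ := S.int (j + k + k + 1)
        obtain ⟨w, hw⟩ := S.int j
        have h6 : a (j + k + k + 1) = a j + 1 := by rw [← S.per]; congr 1; ring
        have q1 := Q.bd (s (j + k + k + 1)) (s j)
        have q2 := Q.bd (s j) (s (j + k + k + 1))
        have r1 : ((z - w - 1 : ℤ) : ℝ) < 1 := by push_cast; linarith
        have r2 : (-1 : ℝ) < ((z - w - 1 : ℤ) : ℝ) := by push_cast; linarith
        have r3 : z - w - 1 < 1 := by exact_mod_cast r1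
        have r4 : -1 < z - w - 1 := by exact_mod_cast r2
        have r5 : z = w + 1 := by omega
        rw [r5] at hz; push_cast at hz; linarith
      rw [N3, e3] at Sn
      rw [N2] at Tn
      have l1 := Sn.lt
      simp only at l1
      have r : (s (j + k + k), s (j + k)) = (t (m + l), t m) := by
        refine hD.overlap Sn Tn e
          ((Q.arc (t m) (s j) + min (Q.arc (t m) (s (j + k + k))) (Q.arc (t m) (t (m + l)))) / 2)
          ?_ ?_ ?_ ?_
        all_goals
          simp only
          rw [e] at l1 ⊢
          have l2 : Q.arc (t m) (s j) < Q.arc (t m) (t (m + l)) := by rw [B1, B2]; linarith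
          have l3 : Q.arc (t m) (t (m + l + 1)) < Q.arc (t m) (s j) := by rw [B1, B3]; linarith
          have := lt_min l1 l2
          have := min_le_left (Q.arc (t m) (s (j + k + k))) (Q.arc (t m) (t (m + l)))
          have := min_le_right (Q.arc (t m) (s (j + k + k))) (Q.arc (t m) (t (m + l)))
          linarith
      rw [← r] at Tn
      have := T.edge m
      rw [← r] at this
      exact hne (cyc_unique hD hc hc' i1 this)
  have h3' := lt_of_le_of_ne h3 eA
  have eB : a j ≠ b (i + 1) := by
    intro h
    have e : t (m + l + 1) = s j := by
      apply Q.arc_inj (t m); rw [B1, B3, bm2, h]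
    have Sn := F_turn hD Xs
    have h6 := cyc_inv hD hc' (T.edge m)
    rw [N2, e] at h6
    have Tn := F_turn hD (cyc_X hD hc' h6)
    have l1 := Tn.lt
    rw [N1] at Sn
    have f1 := Tn.eq
    simp only at f1
    rw [← f1] at l1
    simp only at l1
    have r : (s (j + k), s j) = (t m, s j) := by
      refine hD.overlap Sn Tn rfl
        ((Q.arc (s j) (t m) + max (Q.arc (s j) (s (j + k + 1)))
          (Q.arc (s j) (F hD (t m, s j)).2)) / 2) ?_ ?_ ?_ ?_
      all_goals
        simp only
        have l2 : Q.arc (s j) (s (j + k + 1)) < Q.arc (s j) (t m) := by rw [A1, A3]; linarith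
        have l3 : Q.arc (s j) (t m) < Q.arc (s j) (s (j + k)) := by rw [A1, A2]; linarith
        have := max_lt l2 l1
        have := le_max_left (Q.arc (s j) (s (j + k + 1))) (Q.arc (s j) (F hD (t m, s j)).2)
        have := le_max_right (Q.arc (s j) (s (j + k + 1))) (Q.arc (s j) (F hD (t m, s j)).2)
        linarith
    rw [← r] at h6
    exact hne (cyc_unique hD hc hc' (S.edge j) h6)
  have h2' := lt_of_le_of_ne h2 eB
  refine ⟨s j, t m, (s (j + k), s j), (t (m + l), t m), S.edge j, T.edge m,
    ⟨Xs, rfl, ?_, ?_⟩, ⟨Xt, rfl, ?_, ?_⟩⟩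
  · rw [N1, A1]; simp only; rw [A3]; linarith
  · rw [A1]; simp only; rw [A2]; linarith
  · rw [N2, B1]; simp only; rw [B3]; linarith
  · rw [B1]; simp only; rw [B2]; linarith

end APoly

namespace APoly
set_option linter.unusedSectionVars false
variable {V : Type} {Q : APoly V} {D : Finset (V × V)} [Fintype V]

/-- `c, c'` are the cycles at the two ends of the candidate diagonal. -/
def Ends (hD : Q.DS D) (e : V × V) (p : Equiv.Perm (V × V) × Equiv.Perm (V × V)) : Prop :=
  p.1 ∈ (F hD).cycleFactorsFinset ∧ p.2 ∈ (F hD).cycleFactorsFinset ∧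
  ∃ x y, x ∈ p.1.support ∧ y ∈ p.2.support ∧ Ang hD e.1 e.2 x ∧ Ang hD e.2 e.1 y

theorem ends_exists (hD : Q.DS D) {u v : V} (h : Q.link u v) (hn : (u, v) ∉ D) :
    ∃ p, Ends hD (u, v) p := by
  obtain ⟨x, hx⟩ := exists_Ang hD h hn
  obtain ⟨y, hy⟩ := exists_Ang hD (Q.link_symm h) (fun h' => hn (hD.symm _ _ h'))
  obtain ⟨c, hc, hxc⟩ := cyc_exists hD hx.hX
  obtain ⟨c', hc', hyc⟩ := cyc_exists hD hy.hX
  exact ⟨(c, c'), hc, hc', x, y, hxc, hyc, hx, hy⟩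

theorem Ang.spl {hD : Q.DS D} {u v : V} {a : V × V} (h : Ang hD u v a) : Q.spl u v := by
  obtain ⟨a1, a2⟩ := a
  obtain rfl : a2 = u := h.eq
  have T := F_turn hD h.hX
  have e : (F hD (a1, a2)).1 = a2 := T.eq.symm
  have h1 := hD.in_le h.hX
  have hb := T.hb
  have h2 := hD.out_le (v := (F hD (a1, a2)).1) (w := (F hD (a1, a2)).2) hb
  rw [e] at h2
  exact ⟨lt_of_le_of_lt h2 h.lo, lt_of_lt_of_le h.hi h1⟩

theorem Ang.notMem {hD : Q.DS D} {u v : V} {a : V × V} (h : Ang hD u v a) : (u, v) ∉ D := by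
  intro hd
  obtain ⟨a1, a2⟩ := a
  obtain rfl : a2 = u := h.eq
  have T := F_turn hD h.hX
  have e : (F hD (a1, a2)).1 = a2 := T.eq.symm
  have := T.no v (by rw [e]; exact Or.inr hd)
  rw [e] at this
  exact this ⟨h.lo, h.hi⟩

theorem ends_ang {hD : Q.DS D} {e : V × V} {p : Equiv.Perm (V × V) × Equiv.Perm (V × V)}
    (h : Ends hD e p) {a : V × V} (ha : Ang hD e.1 e.2 a) : a ∈ p.1.support := by
  obtain ⟨_, _, x, y, hx, hy, h1, h2⟩ := h
  rw [ha.unique h1]; exact hx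

theorem ends_ang' {hD : Q.DS D} {e : V × V} {p : Equiv.Perm (V × V) × Equiv.Perm (V × V)}
    (h : Ends hD e p) {a : V × V} (ha : Ang hD e.2 e.1 a) : a ∈ p.2.support := by
  obtain ⟨_, _, x, y, hx, hy, h1, h2⟩ := h
  rw [ha.unique h2]; exact hy

theorem ends_ne (hD : Q.DS D) (hN : (nc hD : ℝ) / 2 = Q.EW) {u v : V} (h : Q.link u v)
    (hn : (u, v) ∉ D) {p : Equiv.Perm (V × V) × Equiv.Perm (V × V)} (hp : Ends hD (u, v) p) :
    p.1 ≠ p.2 := by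
  intro hpe
  have hD' := hD.add h
  have h1 := parity_add hD h hD' hn
  have h2 := nc_le hD'
  rw [← hN] at h2
  have h3 : nc hD' ≤ nc hD := by
    have : (nc hD' : ℝ) ≤ nc hD := by linarith
    exact_mod_cast this
  have hsub : D ⊂ addDiag D u v := by
    refine ⟨Finset.subset_union_left, fun hs => hn (hs (mem_add.mpr (Or.inr (Or.inl rfl))))⟩
  have h4 := nc_ge hD hD' hsub {p.1} (by
    intro u' v' hm hm' a ha
    refine ⟨p.1, Finset.mem_singleton_self _, ?_⟩
    rcases mem_add.mp hm with hm | hm | hm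
    · exact absurd hm hm'
    · cases hm; exact ends_ang hp ha
    · cases hm; rw [hpe]; exact ends_ang' hp ha) (by
    simpa using hp.1)
  rw [Finset.card_singleton] at h4
  omega

theorem ends_inj (hD : Q.DS D) (hN : (nc hD : ℝ) / 2 = Q.EW)
    (hmax : ∀ D' (hD' : Q.DS D'), D ⊂ D' → (nc hD' : ℝ) / 2 ≠ Q.EW) {u v u' v' : V}
    (h : Q.link u v) (hn : (u, v) ∉ D) (h' : Q.link u' v') (hn' : (u', v') ∉ D)
    {p : Equiv.Perm (V × V) × Equiv.Perm (V × V)} (hp : Ends hD (u, v) p)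
    (hp' : Ends hD (u', v') p) : (u, v) = (u', v') := by
  by_contra hne
  have hpn := ends_ne hD hN h hn hp
  have hD1 := hD.add h
  have hn2 : (u', v') ∉ addDiag D u v := by
    intro hm
    rcases mem_add.mp hm with hm | hm | hm
    · exact hn' hm
    · exact hne hm.symm
    · cases hm
      apply hpn
      obtain ⟨x, hx⟩ := exists_Ang hD h hn
      exact cyc_unique hD hp.1 hp.2.1 (ends_ang hp hx) (ends_ang' hp' hx)
  have hD2 := hD1.add h'
  have h1 := parity_add hD h hD1 hn
  have h2 := parity_add hD1 h' hD2 hn2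
  have h3 := nc_le hD2
  rw [← hN] at h3
  have h4 : nc hD2 ≤ nc hD := by
    have : (nc hD2 : ℝ) ≤ nc hD := by linarith
    exact_mod_cast this
  have hsub : D ⊂ addDiag (addDiag D u v) u' v' := by
    refine ⟨Finset.subset_union_left.trans Finset.subset_union_left,
      fun hs => hn' (hs (mem_add.mpr (Or.inr (Or.inl rfl))))⟩
  have h5 := nc_ge hD hD2 hsub {p.1, p.2} (by
    intro x y hm hm' a ha
    rcases mem_add.mp hm with hm | hm | hm
    · rcases mem_add.mp hm with hm | hm | hm
      · exact absurd hm hm'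
      · cases hm; exact ⟨p.1, by simp, ends_ang hp ha⟩
      · cases hm; exact ⟨p.2, by simp, ends_ang' hp ha⟩
    · cases hm; exact ⟨p.1, by simp, ends_ang hp' ha⟩
    · cases hm; exact ⟨p.2, by simp, ends_ang' hp' ha⟩) (by
    intro c hc
    rw [Finset.mem_insert, Finset.mem_singleton] at hc
    rcases hc with rfl | rfl
    · exact hp.1
    · exact hp.2.1)
  rw [Finset.card_pair hpn] at h5
  have h6 : nc hD2 = nc hD := by omega
  apply hmax _ hD2 hsub
  rw [h6, hN]

theorem count_link (hD : Q.DS D) (hN : (nc hD : ℝ) / 2 = Q.EW)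
    (hmax : ∀ D' (hD' : Q.DS D'), D ⊂ D' → (nc hD' : ℝ) / 2 ≠ Q.EW) :
    (Finset.univ.filter fun e : V × V => Q.link e.1 e.2).card
      = D.card + (nc hD * nc hD - nc hD) := by
  have hsub : D ⊆ Finset.univ.filter fun e : V × V => Q.link e.1 e.2 := by
    intro e he
    simpa using hD.link e.1 e.2 he
  rw [← Finset.card_sdiff_add_card_eq_card hsub, add_comm]
  congr 1
  unfold nc
  rw [← Finset.offDiag_card]
  have hex : ∀ e ∈ (Finset.univ.filter fun e : V × V => Q.link e.1 e.2) \ D, ∃ p, Ends hD e p := by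
    rintro ⟨u, v⟩ he
    rw [Finset.mem_sdiff, Finset.mem_filter] at he
    exact ends_exists hD he.1.2 he.2
  choose g hg using hex
  apply Finset.card_bij g
  · rintro ⟨u, v⟩ he
    have hp := hg _ he
    rw [Finset.mem_sdiff, Finset.mem_filter] at he
    rw [Finset.mem_offDiag]
    exact ⟨hp.1, hp.2.1, ends_ne hD hN he.1.2 he.2 hp⟩
  · rintro ⟨u, v⟩ he ⟨u', v'⟩ he' heq
    have hp := hg _ he
    have hp' := hg _ he'
    rw [← heq] at hp'
    rw [Finset.mem_sdiff, Finset.mem_filter] at he he'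
    exact ends_inj hD hN hmax he.1.2 he.2 he'.1.2 he'.2 hp hp'
  · rintro ⟨c, c'⟩ hc
    rw [Finset.mem_offDiag] at hc
    obtain ⟨u, v, x, y, hx, hy, ax, ay⟩ := common_bisector hD hc.1 hc.2.1 hc.2.2
      (cyc_half hD hN hc.1) (cyc_half hD hN hc.2.1)
    have he : (u, v) ∈ (Finset.univ.filter fun e : V × V => Q.link e.1 e.2) \ D := by
      rw [Finset.mem_sdiff, Finset.mem_filter]
      exact ⟨⟨Finset.mem_univ _, ax.spl, ay.spl⟩, ax.notMem⟩
    refine ⟨(u, v), he, ?_⟩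
    have hp := hg _ he
    apply Prod.ext
    · exact cyc_unique hD hp.1 hc.1 (ends_ang hp ax) hx
    · exact cyc_unique hD hp.2.1 hc.2.1 (ends_ang' hp ay) hy

end APoly

/-- normalised angular coordinate -/
def cphi (z : ℂ) : ℝ := Complex.arg z / (2 * Real.pi)

def carc (u v : ℂ) : ℝ := aarc cphi u v

theorem cphi_bd (u v : ℂ) : cphi v - cphi u < 1 := by
  have hpi := Real.pi_pos
  have h1 := Complex.arg_le_pi v
  have h2 := Complex.neg_pi_lt_arg u
  unfold cphi
  rw [← sub_div, div_lt_one (by positivity)]; linarith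

theorem cphi_inj {u v : ℂ} (hu : ‖u‖ = 1) (hv : ‖v‖ = 1) (h : cphi u = cphi v) : u = v := by
  have hpi := Real.pi_pos
  unfold cphi at h
  have h' : arg u = arg v := by
    have h2 : (2 * Real.pi) ≠ 0 := by positivity
    field_simp at h; exact h
  exact Complex.ext_norm_arg (by rw [hu, hv]) h'

theorem posArc_eq {u v : ℂ} (hu : ‖u‖ = 1) (hv : ‖v‖ = 1) :
    posArc u v = 2 * Real.pi * carc u v := by
  have hpi := Real.pi_pos
  have hu0 : u ≠ 0 := by rintro rfl; simp at hu
  have hv0 : v ≠ 0 := by rintro rfl; simp at hv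
  have h := Complex.arg_div_coe_angle hv0 hu0
  rw [← Real.Angle.coe_sub, Real.Angle.angle_eq_iff_two_pi_dvd_sub] at h
  obtain ⟨k, hk⟩ := h
  have b1 := Complex.arg_le_pi (v / u)
  have b2 := Complex.neg_pi_lt_arg (v / u)
  obtain ⟨t, ht0, ht1, m, hm⟩ : ∃ t : ℝ, 0 < t ∧ t ≤ 1 ∧ ∃ m : ℤ, posArc u v = 2 * Real.pi * t ∧
      t = cphi v - cphi u + m := by
    have hsub : cphi v - cphi u = (arg v - arg u) / (2 * Real.pi) := by
      unfold cphi; rw [sub_div]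
    unfold posArc
    split_ifs with h0
    · refine ⟨arg (v / u) / (2 * Real.pi), by positivity, ?_, k, ?_, ?_⟩
      · rw [div_le_one (by positivity)]; linarith
      · field_simp
      · rw [hsub]; field_simp; linarith
    · refine ⟨(arg (v / u) + 2 * Real.pi) / (2 * Real.pi), ?_, ?_, k + 1, ?_, ?_⟩
      · apply div_pos <;> linarith
      · rw [div_le_one (by positivity)]; linarith
      · field_simp
      · rw [hsub]; push_cast; field_simp; linarith
  rw [hm.1]
  congr 1
  have c1 := cphi_bd u v
  have c2 := cphi_bd v u
  unfold carc aarc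
  split_ifs with h0
  · have e1 : (m : ℝ) < 1 := by linarith [hm.2]
    have e2 : (-1 : ℝ) < m := by linarith [hm.2]
    have e1' : m < 1 := by exact_mod_cast e1
    have e2' : -1 < m := by exact_mod_cast e2
    have : m = 0 := by omega
    rw [hm.2, this]; simp
  · have e1 : (m : ℝ) < 2 := by linarith [hm.2]
    have e2 : (0 : ℝ) < m := by linarith [hm.2]
    have e1' : m < 2 := by exact_mod_cast e1
    have e2' : 0 < m := by exact_mod_cast e2
    have : m = 1 := by omega
    rw [hm.2, this]; simp

theorem carc_pos (u v : ℂ) : 0 < carc u v := by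
  have := cphi_bd v u
  unfold carc aarc; split_ifs <;> linarith

theorem carc_le (u v : ℂ) : carc u v ≤ 1 := by
  have := cphi_bd u v
  unfold carc aarc; split_ifs <;> linarith

theorem carc_lt {u v : ℂ} (hu : ‖u‖ = 1) (hv : ‖v‖ = 1) (h : u ≠ v) : carc u v < 1 := by
  have := cphi_bd u v
  have h2 : cphi u ≠ cphi v := fun h' => h (cphi_inj hu hv h')
  unfold carc aarc; split_ifs with h3
  · linarith
  · have : cphi v < cphi u := lt_of_le_of_ne (not_lt.mp h3) (Ne.symm h2)
    linarith

theorem carc_self (u : ℂ) : carc u u = 1 := by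
  unfold carc aarc; simp

theorem posArc_lt_iff {u v w : ℂ} (hu : ‖u‖ = 1) (hv : ‖v‖ = 1) (hw : ‖w‖ = 1) :
    posArc u v < posArc u w ↔ carc u v < carc u w := by
  have hpi := Real.pi_pos
  rw [posArc_eq hu hv, posArc_eq hu hw, mul_lt_mul_iff_right₀ (by positivity)]

theorem point_eq {u v : ℂ} (hu : ‖u‖ = 1) (hv : ‖v‖ = 1) :
    v = u * Complex.exp (((2 * Real.pi * carc u v : ℝ) : ℂ) * I) := by
  have hu0 : u ≠ 0 := by rintro rfl; simp at hu
  rw [← posArc_eq hu hv]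
  have h1 : ‖v / u‖ = 1 := by rw [norm_div, hu, hv]; simp
  have h2 := Complex.norm_mul_exp_arg_mul_I (v / u)
  rw [h1, Complex.ofReal_one, one_mul] at h2
  unfold posArc
  split_ifs
  · rw [h2]; field_simp
  · push_cast
    rw [add_mul, Complex.exp_add, h2, Complex.exp_two_pi_mul_I]; field_simp

theorem sub_eq {u v : ℂ} (hu : ‖u‖ = 1) (hv : ‖v‖ = 1) :
    v - u = u * Complex.exp (((Real.pi * carc u v : ℝ) : ℂ) * I) *
      (2 * I * ((Real.sin (Real.pi * carc u v) : ℝ) : ℂ)) := by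
  have h1 := point_eq hu hv
  set t : ℝ := Real.pi * carc u v with ht
  have e : ((2 * Real.pi * carc u v : ℝ) : ℂ) * I = (t : ℂ) * I + (t : ℂ) * I := by
    rw [ht]; push_cast; ring
  rw [e, Complex.exp_add] at h1
  rw [Complex.ofReal_sin, Complex.sin]
  have h3 : Complex.exp ((t : ℂ) * I) * Complex.exp (-(t : ℂ) * I) = 1 := by
    rw [← Complex.exp_add]; simp
  conv_lhs => rw [h1]
  set x := Complex.exp ((t : ℂ) * I)
  set y := Complex.exp (-(t : ℂ) * I)
  have hI := Complex.I_mul_I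
  linear_combination (-u * x * y + u * x * x) * hI + u * h3

theorem vangle_eq {x v z : ℂ} (hx : ‖x‖ = 1) (hv : ‖v‖ = 1) (hz : ‖z‖ = 1) (hxv : x ≠ v)
    (hzv : z ≠ v) : vangle x v z = Real.pi * |carc v x - carc v z| := by
  have hpi := Real.pi_pos
  have hv0 : v ≠ 0 := by rintro rfl; simp at hv
  have a1 := carc_pos v x
  have a2 := carc_pos v z
  have b1 := carc_lt hv hx hxv.symm
  have b2 := carc_lt hv hz hzv.symm
  set α := Real.pi * carc v x with hα
  set β := Real.pi * carc v z with hβ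
  have sα : 0 < Real.sin α := Real.sin_pos_of_pos_of_lt_pi (by positivity) (by rw [hα]; nlinarith)
  have sβ : 0 < Real.sin β := Real.sin_pos_of_pos_of_lt_pi (by positivity) (by rw [hβ]; nlinarith)
  have key : (x - v) / (z - v) = ((Real.sin α / Real.sin β : ℝ) : ℂ) *
      Complex.exp (((α - β : ℝ) : ℂ) * I) := by
    rw [sub_eq hv hx, sub_eq hv hz]
    have e : Complex.exp (((α - β : ℝ) : ℂ) * I) =
        Complex.exp ((α : ℂ) * I) / Complex.exp ((β : ℂ) * I) := by
      rw [← Complex.exp_sub]; congr 1; push_cast; ring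
    rw [e]
    have n1 : Complex.exp ((β : ℂ) * I) ≠ 0 := Complex.exp_ne_zero _
    have n2 : ((Real.sin β : ℝ) : ℂ) ≠ 0 := by exact_mod_cast sβ.ne'
    rw [Complex.ofReal_div]
    rw [← hα, ← hβ]
    field_simp [Complex.I_ne_zero]
  unfold vangle
  rw [key]
  have h2 : arg (((Real.sin α / Real.sin β : ℝ) : ℂ) * Complex.exp (((α - β : ℝ) : ℂ) * I))
      = α - β := by
    rw [Complex.arg_real_mul _ (div_pos sα sβ)]
    rw [Complex.exp_mul_I, Complex.arg_cos_add_sin_mul_I]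
    constructor <;> nlinarith
  rw [h2, hα, hβ, ← mul_sub, abs_mul, abs_of_pos hpi]

theorem vangle_left (v z : ℂ) : vangle v v z = 0 := by simp [vangle]

theorem vangle_right (x v : ℂ) : vangle x v v = 0 := by simp [vangle]

theorem splits_iff {u v w x : ℂ} (hu : ‖u‖ = 1) (hv : ‖v‖ = 1) (hw : ‖w‖ = 1) (hx : ‖x‖ = 1)
    (huv : u ≠ v) (hwv : w ≠ v) (hlt : carc v w < carc v u) :
    SplitsAngle3 u v w x ↔ carc v w < carc v x ∧ carc v x < carc v u := by
  have hpi := Real.pi_pos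
  by_cases hxv : x = v
  · subst hxv
    constructor
    · rintro ⟨h, _, _⟩; rw [vangle_right] at h; exact absurd h (lt_irrefl _)
    · rintro ⟨_, h⟩
      rw [carc_self] at h
      have := carc_le x u
      linarith
  · unfold SplitsAngle3
    rw [vangle_eq hu hv hx huv hxv, vangle_eq hx hv hw hxv hwv, vangle_eq hu hv hw huv hwv,
      ← mul_add, mul_right_inj' hpi.ne', mul_pos_iff_of_pos_left hpi, mul_pos_iff_of_pos_left hpi,
      abs_pos, abs_pos, abs_of_pos (sub_pos.mpr hlt)]
    constructor
    · rintro ⟨h1, h2, h3⟩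
      have h4 := le_abs_self (carc v u - carc v x)
      have h5 := le_abs_self (carc v x - carc v w)
      have h6 := neg_le_abs (carc v u - carc v x)
      have h7 := neg_le_abs (carc v x - carc v w)
      constructor
      · by_contra hc
        exact h2 (le_antisymm (by linarith) (by linarith))
      · by_contra hc
        exact h1 (le_antisymm (by linarith) (by linarith))
    · rintro ⟨h1, h2⟩
      rw [abs_of_pos (sub_pos.mpr h1), abs_of_pos (sub_pos.mpr h2)]
      exact ⟨by linarith, by linarith, by ring⟩

theorem acw_iff {u v w : ℂ} (hu : ‖u‖ = 1) (hv : ‖v‖ = 1) (hw : ‖w‖ = 1) :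
    ACW u v w ↔ u ≠ v ∧ v ≠ w ∧ carc v w < carc v u := by
  unfold ACW
  rw [posArc_lt_iff hu hv hw]
  by_cases huv : u = v
  · simp [huv]
  by_cases hvw : v = w
  · simp [hvw]
  have h1 : cphi u ≠ cphi v := fun h' => huv (cphi_inj hu hv h')
  have h2 : cphi v ≠ cphi w := fun h' => hvw (cphi_inj hv hw h')
  by_cases huw : u = w
  · subst huw; simp
  have h3 : cphi u ≠ cphi w := fun h' => huw (cphi_inj hu hw h')
  simp only [huv, hvw, huw, ne_eq, not_false_eq_true, true_and]
  have b1 := cphi_bd u v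
  have b2 := cphi_bd v u
  have b3 := cphi_bd u w
  have b4 := cphi_bd w u
  have b5 := cphi_bd w v
  have b6 := cphi_bd v w
  unfold carc aarc
  rcases lt_or_gt_of_ne h1 with h1 | h1 <;> rcases lt_or_gt_of_ne h2 with h2 | h2 <;>
  rcases lt_or_gt_of_ne h3 with h3 | h3 <;>
  simp only [h1, h2, h3, not_lt.mpr h1.le, not_lt.mpr h2.le, not_lt.mpr h3.le, if_true, if_false] <;>
  constructor <;> intro h <;> linarith

namespace CyclicPolygon

variable (P : CyclicPolygon)

theorem next_edge {v : ℂ} (hv : v ∈ P.V) : (v, P.next v) ∈ P.E := by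
  have h : ∃ w, (v, w) ∈ P.E := (P.outdeg v hv).exists
  unfold next; rw [dif_pos h]; exact h.choose_spec

theorem prev_edge {v : ℂ} (hv : v ∈ P.V) : (P.prev v, v) ∈ P.E := by
  have h : ∃ w, (w, v) ∈ P.E := (P.indeg v hv).exists
  unfold prev; rw [dif_pos h]; exact h.choose_spec

theorem edge_next {v w : ℂ} (h : (v, w) ∈ P.E) : w = P.next v :=
  (P.outdeg v (P.endmem _ h).1).unique h (P.next_edge (P.endmem _ h).1)

theorem edge_prev {v w : ℂ} (h : (w, v) ∈ P.E) : w = P.prev v :=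
  (P.indeg v (P.endmem _ h).2).unique h (P.prev_edge (P.endmem _ h).2)

theorem next_mem {v : ℂ} (hv : v ∈ P.V) : P.next v ∈ P.V := (P.endmem _ (P.next_edge hv)).2

theorem prev_mem {v : ℂ} (hv : v ∈ P.V) : P.prev v ∈ P.V := (P.endmem _ (P.prev_edge hv)).1

theorem next_prev {v : ℂ} (hv : v ∈ P.V) : P.next (P.prev v) = v :=
  (P.edge_next (P.prev_edge hv)).symm

theorem prev_next {v : ℂ} (hv : v ∈ P.V) : P.prev (P.next v) = v :=
  (P.edge_prev (P.next_edge hv)).symm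

/-- next as a permutation -/
def nextPerm : Equiv.Perm P.V where
  toFun v := ⟨P.next v, P.next_mem v.2⟩
  invFun v := ⟨P.prev v, P.prev_mem v.2⟩
  left_inv v := Subtype.ext (P.prev_next v.2)
  right_inv v := Subtype.ext (P.next_prev v.2)

theorem consec {u v w : ℂ} (h1 : (u, v) ∈ P.E) (h2 : (v, w) ∈ P.E) :
    u ≠ v ∧ v ≠ w ∧ carc v w < carc v u :=
  (acw_iff (P.onCircle _ (P.endmem _ h1).1) (P.onCircle _ (P.endmem _ h1).2)
    (P.onCircle _ (P.endmem _ h2).2)).mp (P.acw _ _ _ h1 h2)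

/-- the abstract model of a cyclic polygon -/
def toPoly : APoly P.V where
  φ v := cphi v
  inj u v h := Subtype.ext (cphi_inj (P.onCircle _ u.2) (P.onCircle _ v.2) h)
  bd u v := cphi_bd u v
  nxt := P.nextPerm
  turn u := (P.consec (P.prev_edge u.2) (P.next_edge u.2)).2.2

theorem toPoly_arc (u v : P.V) : P.toPoly.arc u v = carc u v := rfl
theorem toPoly_nxt (u : P.V) : ((P.toPoly.nxt u : P.V) : ℂ) = P.next u := rfl
theorem toPoly_prv (u : P.V) : ((P.toPoly.prv u : P.V) : ℂ) = P.prev u := rfl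

theorem edge_iff (u v : P.V) : ((u : ℂ), (v : ℂ)) ∈ P.E ↔ v = P.toPoly.nxt u := by
  constructor
  · intro h; exact Subtype.ext (P.edge_next h)
  · rintro rfl; exact P.next_edge u.2

theorem splits_iff (u v : P.V) : SplitsVertexAngle P u v ↔ P.toPoly.spl u v := by
  have h := P.consec (P.prev_edge u.2) (P.next_edge u.2)
  have e : SplitsVertexAngle P u v ↔ SplitsAngle3 (P.prev u) u (P.next u) v :=
    ⟨fun h => h.2, fun h => ⟨u.2, h⟩⟩
  rw [e, _root_.splits_iff (P.onCircle _ (P.prev_mem u.2)) (P.onCircle _ u.2)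
    (P.onCircle _ (P.next_mem u.2)) (P.onCircle _ v.2) h.1 h.2.1.symm h.2.2]
  rfl

theorem linkable_iff (u v : P.V) : Linkable P u v ↔ P.toPoly.link u v := by
  unfold Linkable LinkablePair APoly.link
  rw [P.splits_iff, P.splits_iff]
  constructor
  · exact fun h => h.2
  · intro h
    exact ⟨fun h' => P.toPoly.link_ne h (Subtype.ext h'), h⟩

theorem linkable_mem {u v : ℂ} (h : Linkable P u v) : u ∈ P.V ∧ v ∈ P.V :=
  ⟨h.2.1.1, h.2.2.1⟩

theorem ncard_linkable : {q : ℂ × ℂ | Linkable P q.1 q.2}.ncard =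
    (Finset.univ.filter fun e : P.V × P.V => P.toPoly.link e.1 e.2).card := by
  rw [← Set.ncard_coe_finset]
  rw [← Set.ncard_image_of_injective (f := fun e : P.V × P.V => ((e.1 : ℂ), (e.2 : ℂ)))]
  · congr 1
    ext ⟨u, v⟩
    simp only [Set.mem_ofPred_eq, Set.mem_image, Finset.coe_filter, Finset.mem_univ, true_and,
      Prod.exists, Prod.mk.injEq]
    constructor
    · intro h
      obtain ⟨hu, hv⟩ := P.linkable_mem h
      exact ⟨⟨u, hu⟩, ⟨v, hv⟩, (P.linkable_iff _ _).mp h, rfl, rfl⟩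
    · rintro ⟨a, b, h, rfl, rfl⟩
      exact (P.linkable_iff _ _).mpr h
  · rintro ⟨a, b⟩ ⟨c, d⟩ h
    simp only [Prod.mk.injEq] at h
    exact Prod.ext (Subtype.ext h.1) (Subtype.ext h.2)

theorem interior_eq (v : P.V) : interiorAngle P v =
    Real.pi * (P.toPoly.arc v (P.toPoly.prv v) - P.toPoly.arc v (P.toPoly.nxt v)) := by
  have h := P.consec (P.prev_edge v.2) (P.next_edge v.2)
  unfold interiorAngle
  rw [vangle_eq (P.onCircle _ (P.prev_mem v.2)) (P.onCircle _ v.2)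
    (P.onCircle _ (P.next_mem v.2)) h.1 h.2.1.symm, abs_of_pos (sub_pos.mpr h.2.2)]
  rfl

theorem sum_interior : ∑ v ∈ P.V, interiorAngle P v = 2 * Real.pi * P.toPoly.EW := by
  rw [← Finset.sum_coe_sort]
  simp_rw [P.interior_eq]
  rw [← Finset.mul_sum, Finset.sum_sub_distrib]
  have e : ∑ v : P.V, P.toPoly.arc v (P.toPoly.prv v) =
      ∑ v : P.V, (1 - P.toPoly.arc v (P.toPoly.nxt v)) := by
    rw [← Equiv.sum_comp P.toPoly.nxt]
    apply Finset.sum_congr rfl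
    intro v _
    rw [P.toPoly.prv_nxt]
    have := P.toPoly.arc_add (P.toPoly.nxt_ne v)
    linarith
  rw [e]
  unfold APoly.EW APoly.W
  rw [← Finset.sum_sub_distrib, mul_assoc, mul_left_comm, Finset.mul_sum, Finset.mul_sum,
    Finset.mul_sum]
  apply Finset.sum_congr rfl
  intro v _; ring

theorem EW_eq {r : ℕ} (hrot : ∑ v ∈ P.V, (Real.pi - interiorAngle P v) = 2 * Real.pi * r) :
    P.toPoly.EW = ((P.V.card : ℝ) - 2 * r) / 2 := by
  have hpi := Real.pi_pos
  rw [Finset.sum_sub_distrib, P.sum_interior] at hrot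
  simp only [Finset.sum_const, nsmul_eq_mul] at hrot
  have : Real.pi * (2 * P.toPoly.EW) = Real.pi * (P.V.card - 2 * r) := by linarith
  have := mul_left_cancel₀ hpi.ne' this
  linarith

end CyclicPolygon

namespace APoly
set_option linter.unusedSectionVars false
variable {V : Type} [Fintype V] (Q : APoly V)

/-- indicator: `q` lies on the half open arc `(u, v]`. -/
theorem arc_ind (u v q : V) : Q.arc u v = Q.arc u q - Q.arc v q +
    (if Q.arc u q ≤ Q.arc u v then (1 : ℝ) else 0) := by
  obtain ⟨a, ha⟩ := Q.arc_int u v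
  obtain ⟨b, hb⟩ := Q.arc_int u q
  obtain ⟨c, hc⟩ := Q.arc_int v q
  split_ifs with h
  · have := Q.arc_eq_of (u := v) (v := q) (t := Q.arc u q - Q.arc u v + 1)
      (by have := Q.arc_pos u q; have := Q.arc_le u v; linarith) (by linarith) (b - a + 1)
      (by push_cast; linarith)
    linarith
  · have := Q.arc_eq_of (u := v) (v := q) (t := Q.arc u q - Q.arc u v)
      (by linarith) (by have := Q.arc_pos u v; have := Q.arc_le u q; linarith) (b - a)
      (by push_cast; linarith)
    linarith

theorem sum_arc (q : V) : ∑ v, Q.arc v (Q.nxt v) =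
    ∑ v, (if Q.arc v q ≤ Q.arc v (Q.nxt v) then (1 : ℝ) else 0) := by
  rw [Finset.sum_congr rfl fun v _ => Q.arc_ind v (Q.nxt v) q, Finset.sum_add_distrib,
    Finset.sum_sub_distrib, Equiv.sum_comp Q.nxt (fun v => Q.arc v q)]
  ring

theorem EW_star (k : ℕ) (hn : Fintype.card V = 2 * k + 1)
    (hk : ∀ v, (Finset.univ.filter fun q => Q.arc v q ≤ Q.arc v (Q.nxt v)).card = k) :
    Q.EW = 1 / 2 := by
  have h1 : (Fintype.card V : ℝ) * ∑ v, Q.arc v (Q.nxt v) = Fintype.card V * k := by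
    have : ∑ _q : V, ∑ v, Q.arc v (Q.nxt v) =
        ∑ q, ∑ v, (if Q.arc v q ≤ Q.arc v (Q.nxt v) then (1 : ℝ) else 0) :=
      Finset.sum_congr rfl fun q _ => Q.sum_arc q
    rw [Finset.sum_comm (s := Finset.univ) (t := Finset.univ)
      (f := fun q v => (if Q.arc v q ≤ Q.arc v (Q.nxt v) then (1 : ℝ) else 0))] at this
    simp only [Finset.sum_boole, hk] at this
    simpa using this
  have h0 : (Fintype.card V : ℝ) ≠ 0 := by rw [hn]; positivity
  have h2 := mul_left_cancel₀ h0 h1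
  unfold EW W
  rw [Finset.sum_sub_distrib, h2]
  simp only [Finset.sum_const, Finset.card_univ, hn, nsmul_eq_mul]
  push_cast; ring

end APoly

namespace CyclicPolygon

theorem card_arc (S : CyclicPolygon) (v w : S.V) (hvw : v ≠ w) :
    (Finset.univ.filter fun q => S.toPoly.arc v q ≤ S.toPoly.arc v w).card
      = edgeLength S v w := by
  unfold edgeLength
  have e : (Finset.univ.filter fun q => S.toPoly.arc v q ≤ S.toPoly.arc v w) =
      insert w (Finset.univ.filter fun q => S.toPoly.arc v q < S.toPoly.arc v w) := by
    ext q
    simp only [Finset.mem_filter, Finset.mem_univ, true_and, Finset.mem_insert]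
    constructor
    · intro h
      rcases h.lt_or_eq with h | h
      · exact Or.inr h
      · exact Or.inl (S.toPoly.arc_inj _ h)
    · rintro (rfl | h)
      · exact le_rfl
      · exact h.le
  rw [e, Finset.card_insert_of_notMem (by simp)]
  congr 1
  rw [← Set.ncard_coe_finset, ← Set.ncard_image_of_injective _ Subtype.val_injective]
  congr 1
  ext q
  simp only [Set.mem_image, Finset.coe_filter, Finset.mem_univ, true_and, Set.mem_ofPred_eq,
    Set.mem_inter_iff, Finset.mem_coe, arcOO]
  constructor
  · rintro ⟨q, h, rfl⟩
    refine ⟨q.2, ?_, ?_, ?_⟩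
    · intro h'
      rw [Subtype.ext h', S.toPoly.arc_self] at h
      have := S.toPoly.arc_le v w
      linarith
    · intro h'
      rw [Subtype.ext h'] at h; exact lt_irrefl _ h
    · exact (posArc_lt_iff (S.onCircle _ v.2) (S.onCircle _ q.2) (S.onCircle _ w.2)).mpr h
  · rintro ⟨hq, h1, h2, h3⟩
    exact ⟨⟨q, hq⟩, (posArc_lt_iff (S.onCircle _ v.2) (S.onCircle _ hq) (S.onCircle _ w.2)).mp h3,
      rfl⟩

theorem star_EW (S : CyclicPolygon) (h : IsStar S) : S.toPoly.EW = 1 / 2 := by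
  obtain ⟨k, hk, h1, h2⟩ := h
  apply APoly.EW_star _ k
  · rw [Fintype.card_coe, h1]
  · intro v
    rw [S.card_arc v _ (S.toPoly.nxt_ne v)]
    exact h2 _ (S.next_edge v.2)

/-- the sum over the edges of a star -/
theorem star_sum (S : CyclicPolygon) (h : IsStar S) :
    ∑ e ∈ S.E, (1 / 2 - carc e.1 e.2) = 1 / 2 := by
  refine Eq.trans ?_ (S.star_EW h)
  unfold APoly.EW
  symm
  apply Finset.sum_bij (fun (v : S.V) _ => ((v : ℂ), S.next v))
  · intro v _; exact S.next_edge v.2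
  · intro u _ v _ h
    exact Subtype.ext (Prod.ext_iff.mp h).1
  · rintro ⟨u, v⟩ he
    exact ⟨⟨u, (S.endmem _ he).1⟩, Finset.mem_univ _, Prod.ext rfl (S.edge_next he).symm⟩
  · intro v _; rfl

end CyclicPolygon

namespace CyclicPolygon
variable (P : CyclicPolygon)

instance vdec : DecidableEq P.V := fun a b => Classical.propDecidable (a = b)

/-- directed diagonals in the abstract model -/
def hat (D : Set (Sym2 ℂ)) : Finset (P.V × P.V) :=
  Finset.univ.filter fun e => s((e.1 : ℂ), (e.2 : ℂ)) ∈ D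

variable {P}

theorem mem_hat {D : Set (Sym2 ℂ)} {u v : P.V} : (u, v) ∈ P.hat D ↔ s((u : ℂ), (v : ℂ)) ∈ D := by
  simp [hat]

theorem hat_DS {D : Set (Sym2 ℂ)} (h : IsDiagonalSet P D) : P.toPoly.DS (P.hat D) := by
  constructor
  · intro u v huv
    rw [mem_hat] at *
    rwa [Sym2.eq_swap]
  · intro u v huv
    rw [mem_hat] at huv
    exact (P.linkable_iff u v).mp (h _ _ huv)

variable (P)
/-- the embedding of abstract directed edges -/
def emb : P.V × P.V ↪ ℂ × ℂ :=
  ⟨fun e => ((e.1 : ℂ), (e.2 : ℂ)), by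
    rintro ⟨a, b⟩ ⟨c, d⟩ h
    simp only [Prod.mk.injEq] at h
    exact Prod.ext (Subtype.ext h.1) (Subtype.ext h.2)⟩

theorem emb_mk (u v : P.V) : P.emb (u, v) = ((u : ℂ), (v : ℂ)) := rfl

variable {P}

theorem X_iff {D : Set (Sym2 ℂ)} (e : P.V × P.V) :
    P.toPoly.X (P.hat D) e ↔ P.emb e ∈ (P.E : Set (ℂ × ℂ)) ∪ tilde D := by
  obtain ⟨u, v⟩ := e
  rw [emb_mk, Set.mem_union, Finset.mem_coe, P.edge_iff]
  unfold APoly.X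
  rw [mem_hat]
  rfl

theorem lift_edge {D : Set (Sym2 ℂ)} (h : IsDiagonalSet P D) {e : ℂ × ℂ}
    (he : e ∈ (P.E : Set (ℂ × ℂ)) ∪ tilde D) : ∃ e' : P.V × P.V, P.emb e' = e := by
  have : e.1 ∈ P.V ∧ e.2 ∈ P.V := by
    rcases he with he | he
    · exact P.endmem _ he
    · exact P.linkable_mem (h _ _ he)
  exact ⟨(⟨e.1, this.1⟩, ⟨e.2, this.2⟩), rfl⟩

theorem decomp_turn {D : Set (Sym2 ℂ)} {𝒮 : Finset CyclicPolygon} (h : IsStarDecomp P D 𝒮)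
    {S : CyclicPolygon} (hS : S ∈ 𝒮) {u v w : P.V} (h1 : P.emb (u, v) ∈ S.E)
    (h2 : P.emb (v, w) ∈ S.E) : P.toPoly.Turn (P.hat D) (u, v) (v, w) := by
  obtain ⟨hd, hs, h3, h4, h5, h6⟩ := h
  have hc := S.consec h1 h2
  have X1 := (X_iff _).mpr (h3 S hS h1)
  have X2 := (X_iff _).mpr (h3 S hS h2)
  refine ⟨X1, X2, rfl, hc.2.2, ?_⟩
  rintro x (hx | hx) ⟨l1, l2⟩
  · simp only at hx l1
    have := (hat_DS hd).out_le X2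
    rw [hx] at l1
    linarith
  · rw [mem_hat] at hx
    refine h6 S hS _ _ _ h1 h2 ⟨x, hx, ?_⟩
    exact (_root_.splits_iff (P.onCircle _ u.2) (P.onCircle _ v.2) (P.onCircle _ w.2)
      (P.onCircle _ x.2) hc.1 hc.2.1.symm hc.2.2).mpr ⟨l1, l2⟩

theorem decomp_inv {D : Set (Sym2 ℂ)} {𝒮 : Finset CyclicPolygon} (h : IsStarDecomp P D 𝒮)
    {S : CyclicPolygon} (hS : S ∈ 𝒮) {e : P.V × P.V} (he : P.emb e ∈ S.E) :
    P.emb (APoly.F (hat_DS h.1) e) ∈ S.E := by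
  obtain ⟨u, v⟩ := e
  have hv : (v : ℂ) ∈ S.V := (S.endmem _ he).2
  have hw : S.next v ∈ P.V := (h.2.1 S hS).2 (S.next_mem hv)
  have h2 : P.emb (v, ⟨S.next v, hw⟩) ∈ S.E := S.next_edge hv
  rw [APoly.F_eq _ (decomp_turn h hS he h2)]
  exact h2

theorem decomp_EW {D : Set (Sym2 ℂ)} {𝒮 : Finset CyclicPolygon} (h : IsStarDecomp P D 𝒮) :
    P.toPoly.EW = 𝒮.card / 2 := by
  rw [← APoly.sum_support (hat_DS h.1)]
  have e : (APoly.F (hat_DS h.1)).support.map P.emb = 𝒮.biUnion fun S => S.E := by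
    ext e
    rw [Finset.mem_map, Finset.mem_biUnion]
    constructor
    · rintro ⟨a, ha, rfl⟩
      rw [APoly.mem_support_F, X_iff] at ha
      exact h.2.2.2.1 _ ha
    · rintro ⟨S, hS, he⟩
      have := h.2.2.1 S hS he
      obtain ⟨a, rfl⟩ := lift_edge h.1 this
      exact ⟨a, by rw [APoly.mem_support_F, X_iff]; exact this, rfl⟩
  have e2 : ∑ a ∈ (APoly.F (hat_DS h.1)).support, P.toPoly.W a =
      ∑ a ∈ (APoly.F (hat_DS h.1)).support.map P.emb, (1 / 2 - carc a.1 a.2) := by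
    rw [Finset.sum_map]; rfl
  rw [e2, e, Finset.sum_biUnion]
  · rw [Finset.sum_congr rfl fun S hS => S.star_sum (h.2.1 S hS).1]
    simp; ring
  · intro S hS S' hS' hne
    rw [Function.onFun, Finset.disjoint_left]
    intro a ha
    exact h.2.2.2.2.1 S hS S' hS' hne a ha

theorem decomp_cyc {D : Set (Sym2 ℂ)} {𝒮 : Finset CyclicPolygon} (h : IsStarDecomp P D 𝒮)
    {S : CyclicPolygon} (hS : S ∈ 𝒮) {c : Equiv.Perm (P.V × P.V)}
    (hc : c ∈ (APoly.F (hat_DS h.1)).cycleFactorsFinset) {e : P.V × P.V} (he : P.emb e ∈ S.E)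
    (hec : e ∈ c.support) {e' : P.V × P.V} (hec' : e' ∈ c.support) : P.emb e' ∈ S.E := by
  have hcyc := (Equiv.Perm.mem_cycleFactorsFinset_iff.mp hc).1
  obtain ⟨i, hi⟩ := hcyc.exists_pow_eq (Equiv.Perm.mem_support.mp hec)
    (Equiv.Perm.mem_support.mp hec')
  have key : ∀ i : ℕ, P.emb ((c ^ i) e) ∈ S.E ∧ (c ^ i) e ∈ c.support := by
    intro i
    induction i with
    | zero => exact ⟨he, hec⟩
    | succ i ih =>
      rw [pow_succ', Equiv.Perm.mul_apply]
      refine ⟨?_, Equiv.Perm.apply_mem_support.mpr ih.2⟩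
      rw [APoly.cyc_eq _ hc ih.2]
      exact decomp_inv h hS ih.1
  rw [← hi]; exact (key i).1

theorem decomp_nc {D : Set (Sym2 ℂ)} {𝒮 : Finset CyclicPolygon} (h : IsStarDecomp P D 𝒮) :
    (APoly.nc (hat_DS h.1) : ℝ) / 2 = P.toPoly.EW := by
  apply le_antisymm (APoly.nc_le _)
  rw [decomp_EW h]
  have : 𝒮.card ≤ APoly.nc (hat_DS h.1) := by
    have hex : ∀ S ∈ 𝒮, ∃ c ∈ (APoly.F (hat_DS h.1)).cycleFactorsFinset,
        ∃ e ∈ c.support, P.emb e ∈ S.E := by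
      intro S hS
      obtain ⟨v, hv⟩ := S.nonempty
      have he := S.next_edge hv
      have := h.2.2.1 S hS he
      obtain ⟨a, ha⟩ := lift_edge h.1 this
      rw [← ha] at he this
      obtain ⟨c, hc, hac⟩ := APoly.cyc_exists (hat_DS h.1) ((X_iff _).mpr this)
      exact ⟨c, hc, a, hac, he⟩
    choose! g hg1 hg2 using hex
    apply Finset.card_le_card_of_injOn g hg1
    intro S hS S' hS' heq
    obtain ⟨e, he, heS⟩ := hg2 S hS
    obtain ⟨e', he', heS'⟩ := hg2 S' hS'
    by_contra hne
    rw [← heq] at he'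
    exact h.2.2.2.2.1 S hS S' hS' hne _ (decomp_cyc h hS (hg1 S hS) heS he he') heS'
  have : (𝒮.card : ℝ) ≤ APoly.nc (hat_DS h.1) := by exact_mod_cast this
  linarith

theorem card_hat {D : Set (Sym2 ℂ)} (h : IsDiagonalSet P D) : (P.hat D).card = 2 * D.ncard := by
  have hD : D = ((P.hat D).image fun e => s((e.1 : ℂ), (e.2 : ℂ)) : Finset (Sym2 ℂ)) := by
    ext z
    rw [Finset.coe_image, Set.mem_image]
    constructor
    · induction z with
      | h u v =>
        intro hz
        have := P.linkable_mem (h _ _ hz)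
        exact ⟨(⟨u, this.1⟩, ⟨v, this.2⟩), mem_hat.mpr hz, rfl⟩
    · rintro ⟨⟨u, v⟩, he, rfl⟩
      exact mem_hat.mp he
  conv_rhs => rw [hD, Set.ncard_coe_finset]
  rw [Finset.card_eq_sum_card_image (fun e : P.V × P.V => s((e.1 : ℂ), (e.2 : ℂ))) (P.hat D)]
  rw [Finset.sum_const_nat (m := 2), mul_comm]
  intro z hz
  rw [Finset.mem_image] at hz
  obtain ⟨⟨u, v⟩, he, rfl⟩ := hz
  have hne := P.toPoly.link_ne ((hat_DS h).link _ _ he)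
  have he' := (hat_DS h).symm _ _ he
  have : (P.hat D).filter (fun a => s((a.1 : ℂ), (a.2 : ℂ)) = s((u : ℂ), (v : ℂ))) =
      {(u, v), (v, u)} := by
    ext ⟨a, b⟩
    rw [Finset.mem_filter, Finset.mem_insert, Finset.mem_singleton, Sym2.eq_iff]
    constructor
    · rintro ⟨_, ⟨h1, h2⟩ | ⟨h1, h2⟩⟩
      · exact Or.inl (Prod.ext (Subtype.ext h1) (Subtype.ext h2))
      · exact Or.inr (Prod.ext (Subtype.ext h1) (Subtype.ext h2))
    · rintro (h1 | h1)
      · cases h1; exact ⟨he, Or.inl ⟨rfl, rfl⟩⟩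
      · cases h1; exact ⟨he', Or.inr ⟨rfl, rfl⟩⟩
  rw [this, Finset.card_pair]
  intro h'
  exact hne (Prod.ext_iff.mp h').1

end CyclicPolygon

namespace APoly
set_option linter.unusedSectionVars false
variable {V : Type} {Q : APoly V} {D : Finset (V × V)} [Fintype V]
variable {hD : Q.DS D} {c : Equiv.Perm (V × V)} {k : ℕ} {a : ℕ → ℝ} {s : ℕ → V}

theorem StarSeq.per_mul (h : StarSeq hD c k a s) (j m : ℕ) :
    a (j + m * (2 * k + 1)) = a j + m := by
  induction m with
  | zero => simp
  | succ m ih =>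
    have : j + (m + 1) * (2 * k + 1) = j + m * (2 * k + 1) + (2 * k + 1) := by ring
    rw [this, h.per, ih]; push_cast; ring

theorem StarSeq.s_eq (h : StarSeq hD c k a s) {i j : ℕ} (z : ℤ) (hz : a i = a j + z) :
    s i = s j := by
  obtain ⟨x, hx⟩ := h.int i
  obtain ⟨y, hy⟩ := h.int j
  apply Q.arc_inj (s j)
  rw [Q.arc_self]
  exact Q.arc_eq_of one_pos le_rfl (1 - x + y + z) (by push_cast; linarith)

theorem StarSeq.s_per (h : StarSeq hD c k a s) (j m : ℕ) : s (j + m * (2 * k + 1)) = s j :=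
  h.s_eq m (by rw [h.per_mul]; simp)

theorem StarSeq.eq_of (h : StarSeq hD c k a s) {i j : ℕ} (hs : s i = s j) :
    (∃ m, i = j + m * (2 * k + 1)) ∨ ∃ m, j = i + m * (2 * k + 1) := by
  obtain ⟨x, hx⟩ := h.int i
  obtain ⟨y, hy⟩ := h.int j
  rw [hs] at hx
  rcases le_total y x with hxy | hxy
  · left
    obtain ⟨m, hm⟩ := Int.eq_ofNat_of_zero_le (sub_nonneg.mpr hxy)
    refine ⟨m, h.mono.injective ?_⟩
    rw [h.per_mul]
    have : ((x - y : ℤ) : ℝ) = m := by rw [hm]; simp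
    push_cast at this; linarith
  · right
    obtain ⟨m, hm⟩ := Int.eq_ofNat_of_zero_le (sub_nonneg.mpr hxy)
    refine ⟨m, h.mono.injective ?_⟩
    rw [h.per_mul]
    have : ((y - x : ℤ) : ℝ) = m := by rw [hm]; simp
    push_cast at this; linarith

theorem StarSeq.shift (h : StarSeq hD c k a s) {i j : ℕ} (t : ℕ) (hs : s i = s j) :
    s (i + t) = s (j + t) := by
  rcases h.eq_of hs with ⟨m, rfl⟩ | ⟨m, rfl⟩
  · rw [add_right_comm, h.s_per]
  · rw [add_right_comm, h.s_per]

theorem StarSeq.shift_k (h : StarSeq hD c k a s) {i j : ℕ} (hs : s (i + k) = s (j + k)) :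
    s i = s j := by
  have := h.shift (k + 1) hs
  have e : ∀ i, i + k + (k + 1) = i + 1 * (2 * k + 1) := by intro i; ring
  rwa [e, e, h.s_per, h.s_per] at this

theorem StarSeq.out_unique (h : StarSeq hD c k a s) {u v w : V} (h1 : (u, v) ∈ c.support)
    (h2 : (u, w) ∈ c.support) : v = w := by
  obtain ⟨i, hi⟩ := h.all _ h1
  obtain ⟨j, hj⟩ := h.all _ h2
  rw [Prod.mk.injEq] at hi hj
  rw [hi.2, hj.2]
  exact h.shift_k (by rw [← hi.1, ← hj.1])

theorem StarSeq.in_unique (h : StarSeq hD c k a s) {u v w : V} (h1 : (v, u) ∈ c.support)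
    (h2 : (w, u) ∈ c.support) : v = w := by
  obtain ⟨i, hi⟩ := h.all _ h1
  obtain ⟨j, hj⟩ := h.all _ h2
  rw [Prod.mk.injEq] at hi hj
  rw [hi.1, hj.1]
  exact h.shift k (by rw [← hi.2, ← hj.2])

theorem StarSeq.rep (h : StarSeq hD c k a s) (i j : ℕ) :
    ∃ m, j ≤ m ∧ m < j + (2 * k + 1) ∧ s i = s m := by
  -- first move `i` beyond `j`
  obtain ⟨i', hi', hs⟩ : ∃ i', j ≤ i' ∧ s i = s i' :=
    ⟨i + j * (2 * k + 1), by nlinarith, (h.s_per i j).symm⟩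
  refine ⟨j + (i' - j) % (2 * k + 1), by omega, ?_, ?_⟩
  · have := Nat.mod_lt (i' - j) (y := 2 * k + 1) (by omega)
    omega
  · rw [hs, ← h.s_per (j + (i' - j) % (2 * k + 1)) ((i' - j) / (2 * k + 1))]
    congr 1
    have := Nat.mod_add_div' (i' - j) (2 * k + 1)
    omega

theorem StarSeq.arc_of (h : StarSeq hD c k a s) {j m : ℕ} (h1 : j < m) (h2 : m < j + (2 * k + 1)) :
    Q.arc (s j) (s m) = 1 - (a m - a j) := by
  apply h.arc_eq h 0 (by simp)
  · exact h.mono h1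
  · rw [← h.per]; exact h.mono h2

theorem StarSeq.open_arc (h : StarSeq hD c k a s) (j : ℕ) :
    ((c.support.image Prod.fst).filter fun q => Q.arc (s j) q < Q.arc (s j) (s (j + k + 1))).card
      + 1 = k := by
  have hk := h.kpos
  have e : ((c.support.image Prod.fst).filter
      fun q => Q.arc (s j) q < Q.arc (s j) (s (j + k + 1))) =
      (Finset.Ioo (j + k + 1) (j + (2 * k + 1))).image s := by
    ext q
    rw [Finset.mem_filter, Finset.mem_image, Finset.mem_image]
    constructor
    · rintro ⟨⟨e, he, rfl⟩, hq⟩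
      obtain ⟨i, rfl⟩ := h.all e he
      simp only at hq ⊢
      obtain ⟨m, m1, m2, m3⟩ := h.rep (i + k) j
      rw [m3] at hq ⊢
      refine ⟨m, ?_, rfl⟩
      rw [Finset.mem_Ioo]
      refine ⟨?_, m2⟩
      rcases m1.eq_or_lt with m1 | m1
      · rw [← m1, Q.arc_self] at hq
        have := Q.arc_le (s j) (s (j + k + 1))
        linarith
      · rw [h.arc_of m1 m2, h.arc_nxt] at hq
        exact h.mono.lt_iff_lt.mp (by linarith)
    · rintro ⟨m, hm, rfl⟩
      rw [Finset.mem_Ioo] at hm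
      refine ⟨⟨_, h.edge (m + (k + 1)), ?_⟩, ?_⟩
      · have := h.s_per m 1
        change s (m + (k + 1) + k) = s m
        rw [← this]; exact congrArg s (by ring)
      · rw [h.arc_of (by omega) hm.2, h.arc_nxt]
        have := h.mono hm.1
        linarith
  rw [e, Finset.card_image_of_injOn, Nat.card_Ioo]
  · omega
  · intro m hm m' hm' heq
    rw [Finset.coe_Ioo, Set.mem_Ioo] at hm hm'
    rcases h.eq_of heq with ⟨x, hx⟩ | ⟨x, hx⟩
    · rcases x with _ | x
      · simpa using hx
      · rw [add_mul] at hx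
        have : 0 ≤ x * (2 * k + 1) := Nat.zero_le _
        omega
    · rcases x with _ | x
      · simpa using hx.symm
      · rw [add_mul] at hx
        have : 0 ≤ x * (2 * k + 1) := Nat.zero_le _
        omega

end APoly

namespace CyclicPolygon
variable {P : CyclicPolygon}

theorem exists_star {D : Finset (P.V × P.V)} (hD : P.toPoly.DS D) {c : Equiv.Perm (P.V × P.V)}
    (hc : c ∈ (APoly.F hD).cycleFactorsFinset) (hW : ∑ e ∈ c.support, P.toPoly.W e = 1 / 2) :
    ∃ S : CyclicPolygon, IsStar S ∧ (S.V : Set ℂ) ⊆ (P.V : Set ℂ) ∧ S.E = c.support.map P.emb := by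
  obtain ⟨k, a, s, h⟩ := APoly.exists_starSeq hD hc hW
  have hmem : ∀ {u v : ℂ}, (u, v) ∈ c.support.map P.emb →
      ∃ u' v' : P.V, (u', v') ∈ c.support ∧ (u' : ℂ) = u ∧ (v' : ℂ) = v := by
    intro u v huv
    rw [Finset.mem_map] at huv
    obtain ⟨⟨u', v'⟩, h1, h2⟩ := huv
    rw [emb_mk, Prod.mk.injEq] at h2
    exact ⟨u', v', h1, h2.1, h2.2⟩
  have hmem' : ∀ {u v : P.V}, (u, v) ∈ c.support → ((u : ℂ), (v : ℂ)) ∈ c.support.map P.emb := by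
    intro u v huv
    exact Finset.mem_map.mpr ⟨_, huv, rfl⟩
  have hnext : ∀ {u v : P.V}, (u, v) ∈ c.support → ∃ w, (v, w) ∈ c.support ∧
      P.toPoly.Turn D (u, v) (v, w) := by
    intro u v huv
    have T := APoly.F_turn hD (APoly.cyc_X hD hc huv)
    have hi := APoly.cyc_inv hD hc huv
    have e : APoly.F hD (u, v) = (v, (APoly.F hD (u, v)).2) := Prod.ext T.eq.symm rfl
    rw [e] at T hi
    exact ⟨_, hi, T⟩
  have hV : ∀ {v : ℂ}, v ∈ (c.support.image Prod.fst).map (Function.Embedding.subtype _) ↔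
      ∃ v' w : P.V, (v', w) ∈ c.support ∧ (v' : ℂ) = v := by
    intro v
    rw [Finset.mem_map]
    constructor
    · rintro ⟨v', h1, h2⟩
      rw [Finset.mem_image] at h1
      obtain ⟨⟨x, y⟩, h3, h4⟩ := h1
      obtain rfl : x = v' := h4
      exact ⟨x, y, h3, h2⟩
    · rintro ⟨v', w, h1, h2⟩
      exact ⟨v', Finset.mem_image.mpr ⟨_, h1, rfl⟩, h2⟩
  let S : CyclicPolygon :=
    { V := (c.support.image Prod.fst).map (Function.Embedding.subtype _)
      E := c.support.map P.emb
      nonempty := ⟨_, hV.mpr ⟨_, _, h.edge 0, rfl⟩⟩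
      onCircle := by
        intro v hv
        obtain ⟨v', _, _, rfl⟩ := hV.mp hv
        exact P.onCircle _ v'.2
      endmem := by
        rintro ⟨u, v⟩ he
        obtain ⟨u', v', h1, rfl, rfl⟩ := hmem he
        obtain ⟨w, hw, _⟩ := hnext h1
        exact ⟨hV.mpr ⟨_, _, h1, rfl⟩, hV.mpr ⟨_, _, hw, rfl⟩⟩
      outdeg := by
        intro v hv
        obtain ⟨v', w, h1, rfl⟩ := hV.mp hv
        refine ⟨w, hmem' h1, ?_⟩
        intro y hy
        obtain ⟨u', y', h2, e1, rfl⟩ := hmem hy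
        rw [Subtype.ext e1] at h2
        rw [h.out_unique h1 h2]
      indeg := by
        intro v hv
        obtain ⟨v', w, h1, rfl⟩ := hV.mp hv
        obtain ⟨j, hj⟩ := h.all _ h1
        rw [Prod.mk.injEq] at hj
        have h1 := h.edge (j + k)
        rw [← hj.1] at h1
        refine ⟨_, hmem' h1, ?_⟩
        intro y hy
        obtain ⟨y', u', h2, rfl, e1⟩ := hmem hy
        rw [Subtype.ext e1] at h2
        rw [h.in_unique h1 h2]
      acw := by
        intro u v w m1 m2
        obtain ⟨u', v', h1, rfl, rfl⟩ := hmem m1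
        obtain ⟨x', w', h2, e1, rfl⟩ := hmem m2
        rw [Subtype.ext e1] at h2
        obtain ⟨w, hw, T⟩ := hnext h1
        rw [h.out_unique hw h2] at T
        rw [acw_iff (P.onCircle _ u'.2) (P.onCircle _ v'.2) (P.onCircle _ w'.2)]
        refine ⟨?_, ?_, T.lt⟩
        · intro h'; exact hD.ne T.ha (Subtype.ext h')
        · intro h'; exact hD.ne T.hb (Subtype.ext h') }
  refine ⟨S, ⟨k, h.kpos, ?_, ?_⟩, ?_, rfl⟩
  · change ((c.support.image Prod.fst).map (Function.Embedding.subtype _)).card = _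
    rw [Finset.card_map, Finset.card_image_of_injOn, h.card]
    rintro ⟨u, v⟩ h1 ⟨u', v'⟩ h2 heq
    obtain rfl : u = u' := heq
    rw [h.out_unique h1 h2]
  · rintro ⟨u, v⟩ he
    obtain ⟨u', v', h1, rfl, rfl⟩ := hmem he
    obtain ⟨j, hj⟩ := h.all _ h1
    rw [Prod.mk.injEq] at hj
    have e1 : v' = s (j + k + k + 1) := by
      rw [hj.2, ← h.s_per j 1]; congr 1; ring
    have ho := h.open_arc (j + k)
    rw [← e1, ← hj.1] at ho
    unfold edgeLength
    rw [← ho, ← Set.ncard_coe_finset, ← Set.ncard_image_of_injective _ Subtype.val_injective]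
    congr 2
    ext q
    simp only [Set.mem_image, Finset.mem_coe, Set.mem_inter_iff, arcOO, Set.mem_ofPred_eq,
      Finset.mem_filter, Finset.mem_image]
    constructor
    · rintro ⟨hq, q1, q2, q3⟩
      obtain ⟨q', w, hw, rfl⟩ := hV.mp hq
      exact ⟨q', ⟨⟨_, hw, rfl⟩, (posArc_lt_iff (P.onCircle _ u'.2) (P.onCircle _ q'.2)
        (P.onCircle _ v'.2)).mp q3⟩, rfl⟩
    · rintro ⟨q', ⟨⟨⟨x, y⟩, hw, e2⟩, hlt⟩, rfl⟩
      obtain rfl : x = q' := e2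
      refine ⟨hV.mpr ⟨_, _, hw, rfl⟩, ?_, ?_, (posArc_lt_iff (P.onCircle _ u'.2)
        (P.onCircle _ x.2) (P.onCircle _ v'.2)).mpr hlt⟩
      · intro h'
        rw [Subtype.ext h', P.toPoly.arc_self] at hlt
        have := P.toPoly.arc_le u' v'
        linarith
      · intro h'
        rw [Subtype.ext h'] at hlt; exact lt_irrefl _ hlt
  · intro v hv
    obtain ⟨v', _, _, rfl⟩ := hV.mp hv
    exact v'.2

theorem has_decomp {D : Set (Sym2 ℂ)} (hd : IsDiagonalSet P D)
    (hN : (APoly.nc (hat_DS hd) : ℝ) / 2 = P.toPoly.EW) : HasStarDecomp P D := by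
  have hex : ∀ c ∈ (APoly.F (hat_DS hd)).cycleFactorsFinset, ∃ S : CyclicPolygon,
      IsStar S ∧ (S.V : Set ℂ) ⊆ (P.V : Set ℂ) ∧ S.E = c.support.map P.emb := by
    intro c hc
    exact exists_star _ hc (APoly.cyc_half _ hN hc)
  have hS0 : Nonempty CyclicPolygon := ⟨P⟩
  choose! g hg using hex
  refine ⟨(APoly.F (hat_DS hd)).cycleFactorsFinset.image g, hd, ?_, ?_, ?_, ?_, ?_⟩
  · intro S hS
    obtain ⟨c, hc, rfl⟩ := Finset.mem_image.mp hS
    exact ⟨(hg c hc).1, (hg c hc).2.1⟩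
  · intro S hS e he
    obtain ⟨c, hc, rfl⟩ := Finset.mem_image.mp hS
    rw [Finset.mem_coe, (hg c hc).2.2, Finset.mem_map] at he
    obtain ⟨a, ha, rfl⟩ := he
    exact (X_iff _).mp (APoly.cyc_X _ hc ha)
  · intro e he
    obtain ⟨a, rfl⟩ := lift_edge hd he
    obtain ⟨c, hc, hac⟩ := APoly.cyc_exists (hat_DS hd) ((X_iff _).mpr he)
    refine ⟨g c, Finset.mem_image_of_mem _ hc, ?_⟩
    rw [(hg c hc).2.2]
    exact Finset.mem_map_of_mem _ hac
  · intro S hS S' hS' hne e he he'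
    obtain ⟨c, hc, rfl⟩ := Finset.mem_image.mp hS
    obtain ⟨c', hc', rfl⟩ := Finset.mem_image.mp hS'
    rw [(hg c hc).2.2, Finset.mem_map] at he
    rw [(hg c' hc').2.2, Finset.mem_map] at he'
    obtain ⟨a, ha, rfl⟩ := he
    obtain ⟨a', ha', heq⟩ := he'
    rw [P.emb.injective heq] at ha'
    exact hne (by rw [APoly.cyc_unique _ hc hc' ha ha'])
  · rintro S hS u v w h1 h2 ⟨x, hx, hsp⟩
    obtain ⟨c, hc, rfl⟩ := Finset.mem_image.mp hS
    have hcon := (g c).consec h1 h2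
    have hout := (g c).outdeg v ((g c).endmem _ h1).2
    obtain ⟨h1V, h2V⟩ := P.linkable_mem (hd _ _ hx)
    have hE := (hg c hc).2.2
    rw [hE, Finset.mem_map] at h1 h2
    obtain ⟨⟨u, v⟩, ha, e1⟩ := h1
    obtain ⟨⟨v', w⟩, hb, e2⟩ := h2
    rw [emb_mk, Prod.mk.injEq] at e1 e2
    obtain ⟨rfl, rfl⟩ := e1
    obtain ⟨e2, rfl⟩ := e2
    obtain rfl := Subtype.ext e2
    have T := APoly.F_turn (hat_DS hd) (APoly.cyc_X _ hc ha)
    have hi := APoly.cyc_inv _ hc ha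
    have e3 : APoly.F (hat_DS hd) (u, v') = (v', (APoly.F (hat_DS hd) (u, v')).2) :=
      Prod.ext T.eq.symm rfl
    rw [e3] at T hi
    have e4 : (APoly.F (hat_DS hd) (u, v')).2 = w := by
      apply Subtype.ext
      apply hout.unique
      · rw [hE]; exact Finset.mem_map_of_mem P.emb hi
      · rw [hE]; exact Finset.mem_map_of_mem P.emb hb
    rw [e4] at T
    have := (_root_.splits_iff (P.onCircle _ u.2) (P.onCircle _ v'.2) (P.onCircle _ w.2)
      (P.onCircle _ h2V) hcon.1 hcon.2.1.symm hcon.2.2).mp hsp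
    exact T.no ⟨x, h2V⟩ (Or.inr (mem_hat.mpr hx)) this

theorem max_transfer {D : Set (Sym2 ℂ)} (hd : IsDiagonalSet P D)
    (hmax : ∀ D' : Set (Sym2 ℂ), D ⊂ D' → ¬ HasStarDecomp P D') (D1 : Finset (P.V × P.V))
    (hD1 : P.toPoly.DS D1) (hsub : P.hat D ⊂ D1) : (APoly.nc hD1 : ℝ) / 2 ≠ P.toPoly.EW := by
  intro hN
  have hS : ∀ u v : ℂ, s(u, v) ∈ {z : Sym2 ℂ | ∃ a b : P.V, (a, b) ∈ D1 ∧ z = s((a : ℂ), (b : ℂ))} →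
      ∃ a b : P.V, (a, b) ∈ D1 ∧ (a : ℂ) = u ∧ (b : ℂ) = v := by
    rintro u v ⟨a, b, hab, he⟩
    rw [Sym2.eq_iff] at he
    rcases he with ⟨rfl, rfl⟩ | ⟨rfl, rfl⟩
    · exact ⟨a, b, hab, rfl, rfl⟩
    · exact ⟨b, a, hD1.symm _ _ hab, rfl, rfl⟩
  set D' : Set (Sym2 ℂ) := {z | ∃ a b : P.V, (a, b) ∈ D1 ∧ z = s((a : ℂ), (b : ℂ))} with hD'
  have hd' : IsDiagonalSet P D' := by
    intro u v huv
    obtain ⟨a, b, hab, rfl, rfl⟩ := hS u v huv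
    exact (P.linkable_iff a b).mpr (hD1.link _ _ hab)
  have he : D1 = P.hat D' := by
    ext ⟨u, v⟩
    rw [mem_hat]
    constructor
    · intro h; exact ⟨u, v, h, rfl⟩
    · intro h
      obtain ⟨a, b, hab, e1, e2⟩ := hS u v h
      rw [← Subtype.ext e1, ← Subtype.ext e2]; exact hab
  clear_value D'
  subst he
  apply hmax D' _ (has_decomp hd' hN)
  constructor
  · intro z
    induction z with
    | h u v =>
      intro hz
      obtain ⟨hu, hv⟩ := P.linkable_mem (hd _ _ hz)
      have : ((⟨u, hu⟩, ⟨v, hv⟩) : P.V × P.V) ∈ P.hat D := mem_hat.mpr hz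
      exact mem_hat.mp (hsub.1 this)
  · intro hs
    apply hsub.2
    rintro ⟨u, v⟩ h
    rw [mem_hat] at h ⊢
    exact hs h

end CyclicPolygon

/-- If a cyclic polygon `P` with `n` vertices, `p` linkable pairs and rotation
number `r` admits a star decomposition, then every maximal star decomposition of `P` contains
exactly `p - (n - 2r)(n - 2r - 1)/2` diagonals. -/
theorem num_diagonals (P : CyclicPolygon) (r p : ℕ) (hr : 0 < r)
    (hrot : ∑ v ∈ P.V, (Real.pi - interiorAngle P v) = 2 * Real.pi * r)
    (hp : {q : ℂ × ℂ | Linkable P q.1 q.2}.ncard = 2 * p)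
    (hadmits : ∃ D₀ : Set (Sym2 ℂ), HasStarDecomp P D₀)
    (D : Set (Sym2 ℂ)) (𝒮 : Finset CyclicPolygon) (h : IsMaximalStarDecomp P D 𝒮) :
    (D.ncard : ℚ) =
      (p : ℚ) - ((P.V.card : ℚ) - 2 * r) * ((P.V.card : ℚ) - 2 * r - 1) / 2 := by
  have hN := CyclicPolygon.decomp_nc h.1
  have hcount := APoly.count_link (CyclicPolygon.hat_DS h.1.1) hN
    (CyclicPolygon.max_transfer h.1.1 h.2)
  rw [← P.ncard_linkable, hp, CyclicPolygon.card_hat h.1.1] at hcount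
  rw [P.EW_eq hrot] at hN
  set N := APoly.nc (CyclicPolygon.hat_DS h.1.1) with hNdef
  have h1 : (N : ℝ) + 2 * r = P.V.card := by linarith
  have h2 : N + 2 * r = P.V.card := by exact_mod_cast h1
  have h3 : (P.V.card : ℚ) = N + 2 * r := by rw [← h2]; push_cast; ring
  have h4 : N ≤ N * N := Nat.le_mul_self N
  have h5 : ((2 * p : ℕ) : ℚ) = ((2 * D.ncard + (N * N - N) : ℕ) : ℚ) := by rw [hcount]
  rw [Nat.cast_add, Nat.cast_sub h4] at h5
  push_cast at h5
  rw [h3]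
  linarith

end
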